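/- Suppose that R is Henselian. Let M be a finitely generated R-module and 0 → M →d⁰ X⁰ →d¹ X¹ →d² ⋯ a special proper CM-coresolution of M; put μ⁰ := d⁰ and let μ^i : coker d^{i−1} → X^i be the induced homomorphisms. Then for each i ≥ 0 one has cod(ker μ^i) > i, and there exists an exact sequence 0 → S^i → coker μ^i → T^i → U^i → 0 of finitely generated R-modules such that cod S^i > i+1, cod U^i > i+2, T^i satisfies (S_2), and (T^i)† has finite injective dimension and satisfies (S_{i+3}). -/

import Mathlib

open CategoryTheory

noncomputable section

/-- `Ext^n_A(M, N)` as a module. -/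
def ext1 (A : Type) [CommRing A] (n : ℕ) (M N : Type) [AddCommGroup M] [Module A M]
    [AddCommGroup N] [Module A N] : ModuleCat A :=
  ((Ext A (ModuleCat A) n).obj (Opposite.op (ModuleCat.of A M))).obj (ModuleCat.of A N)

/-- The depth of a module over a local ring: the least `n` with `Ext^n(k, M) ≠ 0`
(`⊤` if no such `n`, e.g. for the zero module). -/
def rdepth (A : Type) [CommRing A] [IsLocalRing A] (M : Type) [AddCommGroup M] [Module A M] :
    ℕ∞ :=
  sInf {n : ℕ∞ | ∃ m : ℕ, n = m ∧ ¬ Subsingleton (ext1 A m (IsLocalRing.ResidueField A) M)}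

/-- The dimension of a module, `dim M = dim (A / ann M)`. -/
def mdim (A : Type) [CommRing A] (M : Type) [AddCommGroup M] [Module A M] : WithBot ℕ∞ :=
  ringKrullDim (A ⧸ Module.annihilator A M)

/-- `cod M > n`, i.e. `dim A - dim M > n`, i.e. `dim M + n < d`. -/
def codGT (A : Type) [CommRing A] (d : ℕ) (M : Type) [AddCommGroup M] [Module A M]
    (n : ℕ) : Prop :=
  mdim A M + n < (d : WithBot ℕ∞)

/-- `cod M ≥ n`, i.e. `dim M + n ≤ d`. -/
def codGE (A : Type) [CommRing A] (d : ℕ) (M : Type) [AddCommGroup M] [Module A M]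
    (n : ℕ) : Prop :=
  mdim A M + n ≤ (d : WithBot ℕ∞)

/-- Maximal Cohen-Macaulay module over a `d`-dimensional local ring
(the zero module counts as MCM). -/
def IsMCM (A : Type) [CommRing A] [IsLocalRing A] (d : ℕ) (M : Type) [AddCommGroup M]
    [Module A M] : Prop :=
  Module.Finite A M ∧ (d : ℕ∞) ≤ rdepth A M

/-- Serre's condition `(S_n)`: `depth M_p ≥ min {n, ht p}` for all primes `p`. -/
def SerreS (A : Type) [CommRing A] (n : ℕ) (M : Type) [AddCommGroup M] [Module A M] : Prop :=
  ∀ p : PrimeSpectrum A,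
    min (n : WithBot ℕ∞) (ringKrullDim (Localization.AtPrime p.asIdeal))
      ≤ (rdepth (Localization.AtPrime p.asIdeal)
          (LocalizedModule p.asIdeal.primeCompl M) : ℕ∞)

/-- Finite injective dimension: `Ext^m(-, M)` vanishes for all large `m`. -/
def HasFID (A : Type) [CommRing A] (M : Type) [AddCommGroup M] [Module A M] : Prop :=
  ∃ n : ℕ, ∀ (N : Type) [AddCommGroup N] [Module A N], ∀ m : ℕ, n < m →
    Subsingleton (ext1 A m N M)

/-- `ω` is a canonical module of the `d`-dimensional local ring `A`:
it is maximal Cohen-Macaulay, of finite injective dimension, and of type one. -/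
def IsCanonicalModule (A : Type) [CommRing A] [IsLocalRing A] (d : ℕ) (ω : Type)
    [AddCommGroup ω] [Module A ω] : Prop :=
  IsMCM A d ω ∧ HasFID A ω ∧
    Nonempty ((ext1 A d (IsLocalRing.ResidueField A) ω) ≃ₗ[A] IsLocalRing.ResidueField A)

/-- `μ : M → X` is a CM-preenvelope. -/
def IsCMPreenvelope (A : Type) [CommRing A] [IsLocalRing A] (d : ℕ) {M X : Type}
    [AddCommGroup M] [Module A M] [AddCommGroup X] [Module A X] (μ : M →ₗ[A] X) : Prop :=
  IsMCM A d X ∧ ∀ (Z : Type) [AddCommGroup Z] [Module A Z], IsMCM A d Z →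
    ∀ f : M →ₗ[A] Z, ∃ g : X →ₗ[A] Z, g ∘ₗ μ = f

/-- `μ : M → X` is a special CM-preenvelope: a CM-preenvelope with
`Ext^1(coker μ, Z) = 0` for all maximal Cohen-Macaulay `Z`. -/
def IsSpecialCMPreenvelope (A : Type) [CommRing A] [IsLocalRing A] (d : ℕ) {M X : Type}
    [AddCommGroup M] [Module A M] [AddCommGroup X] [Module A X] (μ : M →ₗ[A] X) : Prop :=
  IsCMPreenvelope A d μ ∧ ∀ (Z : Type) [AddCommGroup Z] [Module A Z], IsMCM A d Z →
    Subsingleton (ext1 A 1 (X ⧸ LinearMap.range μ) Z)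

/-- `μ : M → X` is a CM-envelope. -/
def IsCMEnvelope (A : Type) [CommRing A] [IsLocalRing A] (d : ℕ) {M X : Type}
    [AddCommGroup M] [Module A M] [AddCommGroup X] [Module A X] (μ : M →ₗ[A] X) : Prop :=
  IsCMPreenvelope A d μ ∧ ∀ φ : X →ₗ[A] X, φ ∘ₗ μ = μ → Function.Bijective φ

/-- `π : X → M` is a CM-precover. -/
def IsCMPrecover (A : Type) [CommRing A] [IsLocalRing A] (d : ℕ) {X M : Type}
    [AddCommGroup X] [Module A X] [AddCommGroup M] [Module A M] (π : X →ₗ[A] M) : Prop :=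
  IsMCM A d X ∧ ∀ (Z : Type) [AddCommGroup Z] [Module A Z], IsMCM A d Z →
    ∀ f : Z →ₗ[A] M, ∃ g : Z →ₗ[A] X, π ∘ₗ g = f

/-- `π : X → M` is a special CM-precover: a CM-precover with
`Ext^1(Z, ker π) = 0` for all maximal Cohen-Macaulay `Z`. -/
def IsSpecialCMPrecover (A : Type) [CommRing A] [IsLocalRing A] (d : ℕ) {X M : Type}
    [AddCommGroup X] [Module A X] [AddCommGroup M] [Module A M] (π : X →ₗ[A] M) : Prop :=
  IsCMPrecover A d π ∧ ∀ (Z : Type) [AddCommGroup Z] [Module A Z], IsMCM A d Z →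
    Subsingleton (ext1 A 1 Z ↥(LinearMap.ker π))

/-- `π : X → M` is a CM-cover. -/
def IsCMCover (A : Type) [CommRing A] [IsLocalRing A] (d : ℕ) {X M : Type}
    [AddCommGroup X] [Module A X] [AddCommGroup M] [Module A M] (π : X →ₗ[A] M) : Prop :=
  IsCMPrecover A d π ∧ ∀ φ : X →ₗ[A] X, π ∘ₗ φ = π → Function.Bijective φ

/-- `M` has no nonzero free direct summand. -/
def NoNonzeroFreeSummand (A : Type) [CommRing A] (M : Type) [AddCommGroup M]
    [Module A M] : Prop :=
  ∀ F G : Submodule A M, IsCompl F G → Module.Free A ↥F → F = ⊥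

/-- `W` belongs to `add ω`: it is a direct summand of a finite direct sum of copies of `ω`. -/
def InAdd (A : Type) [CommRing A] (ω : Type) [AddCommGroup ω] [Module A ω] (W : Type)
    [AddCommGroup W] [Module A W] : Prop :=
  ∃ (n : ℕ) (W' : ModuleCat.{0} A), Nonempty ((W × ↥W') ≃ₗ[A] (Fin n → ω))

section delta

variable (A : Type) [CommRing A] (ω : Type) [AddCommGroup ω] [Module A ω]

/-- The natural evaluation map `δ_M : M → M†† = Hom(Hom(M, ω), ω)`. -/
def deltaMap (M : Type) [AddCommGroup M] [Module A M] :
    M →ₗ[A] ((M →ₗ[A] ω) →ₗ[A] ω) :=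
  (LinearMap.id : (M →ₗ[A] ω) →ₗ[A] (M →ₗ[A] ω)).flip

/-- The dual `f† = Hom(f, ω)` of a linear map `f`. -/
def dmap {M N : Type} [AddCommGroup M] [Module A M] [AddCommGroup N] [Module A N]
    (f : M →ₗ[A] N) : (N →ₗ[A] ω) →ₗ[A] (M →ₗ[A] ω) :=
  LinearMap.lcomp A ω f

end delta

/-- The homology `ker g / im f` at the middle spot of `M → N → P`. -/
abbrev homMod (A : Type) [CommRing A] {M N P : Type} [AddCommGroup M] [Module A M]
    [AddCommGroup N] [Module A N] [AddCommGroup P] [Module A P]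
    (f : M →ₗ[A] N) (g : N →ₗ[A] P) : Type :=
  ↥(LinearMap.ker g) ⧸ Submodule.comap (LinearMap.ker g).subtype (LinearMap.range f)

end

noncomputable section Coresolution

variable (R : Type) [CommRing R] [IsLocalRing R]
  (M : Type) [AddCommGroup M] [Module R M]
  (X : ℕ → ModuleCat.{0} R)
  (d0 : M →ₗ[R] ↥(X 0)) (dn : ∀ i, ↥(X i) →ₗ[R] ↥(X (i+1)))

/-- `coker d^{i-1}`, the source of the induced map `μ^i` (for `i = 0` it is `M`). -/
def cokerAt : ℕ → Type
  | 0 => M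
  | 1 => ↥(X 0) ⧸ LinearMap.range d0
  | (i+2) => ↥(X (i+1)) ⧸ LinearMap.range (dn i)

instance cokerAtAddCommGroup : ∀ i, AddCommGroup (cokerAt R M X d0 dn i)
  | 0 => inferInstanceAs (AddCommGroup M)
  | 1 => inferInstanceAs (AddCommGroup (↥(X 0) ⧸ LinearMap.range d0))
  | (i+2) => inferInstanceAs (AddCommGroup (↥(X (i+1)) ⧸ LinearMap.range (dn i)))

instance cokerAtModule : ∀ i, Module R (cokerAt R M X d0 dn i)
  | 0 => inferInstanceAs (Module R M)
  | 1 => inferInstanceAs (Module R (↥(X 0) ⧸ LinearMap.range d0))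
  | (i+2) => inferInstanceAs (Module R (↥(X (i+1)) ⧸ LinearMap.range (dn i)))

variable (hc0 : LinearMap.range d0 ≤ LinearMap.ker (dn 0))
  (hc : ∀ i, LinearMap.range (dn i) ≤ LinearMap.ker (dn (i+1)))

/-- The induced map `μ^i : coker d^{i-1} → X^i`. -/
def muAt : ∀ i, cokerAt R M X d0 dn i →ₗ[R] ↥(X i)
  | 0 => d0
  | 1 => Submodule.liftQ _ (dn 0) hc0
  | (i+2) => Submodule.liftQ _ (dn (i+1)) (hc i)

/-- The complex `0 → M → X⁰ → X¹ → ⋯` of maximal Cohen-Macaulay modules is a special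
proper CM-coresolution of `M` if every induced map `μ^i` is a special CM-preenvelope. -/
def IsSpecialProperCMCoresolution (d : ℕ) : Prop :=
  (∀ i, IsMCM R d ↥(X i)) ∧ ∀ i, IsSpecialCMPreenvelope R d (muAt R M X d0 dn hc0 hc i)

/-- The complex `0 → M → X⁰ → X¹ → ⋯` of maximal Cohen-Macaulay modules is a minimal
proper CM-coresolution of `M` if every induced map `μ^i` is a CM-envelope. -/
def IsMinimalProperCMCoresolution (d : ℕ) : Prop :=
  (∀ i, IsMCM R d ↥(X i)) ∧ ∀ i, IsCMEnvelope R d (muAt R M X d0 dn hc0 hc i)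

end Coresolution

noncomputable section ExtComparison

open CategoryTheory.Abelian

namespace CategoryTheory.ProjectiveResolution

universe w v u
variable {C : Type u} [Category.{v} C] [Abelian C] [HasExt.{w} C] {X Y : C}
  (P : ProjectiveResolution X)

lemma extMk_zero_eq_zero_iff (f : P.complex.X 0 ⟶ Y)
    (hf : P.complex.d 1 0 ≫ f = 0) :
    P.extMk f 1 rfl hf = 0 ↔ f = 0 := by
  refine ⟨fun h => ?_, fun h => by subst h; simp⟩
  rw [← P.extEquivCohomologyClass.apply_eq_iff_eq,
    extEquivCohomologyClass_extMk, extEquivCohomologyClass_zero,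
    CochainComplex.HomComplex.CohomologyClass.mk_eq_zero_iff,
    CochainComplex.HomComplex.Cocycle.toSingleMk_mem_coboundaries_iff _ _ _ _ _ 1 (by simp)] at h
  obtain ⟨g, hg⟩ := h
  have hz : Limits.IsZero (P.cochainComplex.X 1) :=
    P.cochainComplex.isZero_of_isStrictlyLE 0 1 (by simp)
  rw [hz.eq_of_src g 0, Limits.comp_zero] at hg
  rw [← cancel_epi (P.cochainComplexXIso (-(0 : ℕ)) 0 rfl).hom, ← hg, Limits.comp_zero]

end CategoryTheory.ProjectiveResolution

variable {A : Type} [CommRing A] {X Y : ModuleCat.{0} A} (P : ProjectiveResolution X)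

lemma mem_ker_sc_linearYonedaObj (n : ℕ) (f : P.complex.X n ⟶ Y) :
    f ∈ LinearMap.ker (((P.complex.linearYonedaObj A Y).sc n).g.hom) ↔
      P.complex.d (n + 1) n ≫ f = 0 := by
  have : ∀ m, m = n + 1 → (((P.complex.linearYonedaObj A Y).d n m).hom f = 0 ↔
      P.complex.d (n + 1) n ≫ f = 0) := by
    rintro m rfl
    rfl
  exact this _ (by simp)

lemma mem_range_sc_linearYonedaObj_succ (n : ℕ) (f : P.complex.X (n + 1) ⟶ Y) :
    f ∈ LinearMap.range (((P.complex.linearYonedaObj A Y).sc (n + 1)).f.hom) ↔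
      ∃ g : P.complex.X n ⟶ Y, P.complex.d (n + 1) n ≫ g = f := by
  have : ∀ m, m = n → (f ∈ LinearMap.range ((P.complex.linearYonedaObj A Y).d m (n + 1)).hom ↔
      ∃ g : P.complex.X n ⟶ Y, P.complex.d (n + 1) n ≫ g = f) := by
    rintro m rfl
    rfl
  exact this _ (by simp)

lemma mem_range_sc_linearYonedaObj_zero (f : P.complex.X 0 ⟶ Y) :
    f ∈ LinearMap.range (((P.complex.linearYonedaObj A Y).sc 0).f.hom) ↔ f = 0 := by
  have : ((P.complex.linearYonedaObj A Y).sc 0).f = 0 :=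
    (P.complex.linearYonedaObj A Y).shape _ _ (by simp)
  rw [this, ModuleCat.hom_zero, LinearMap.range_zero]
  exact Submodule.mem_bot (M := ((P.complex.linearYonedaObj A Y).sc 0).X₂) A

/-- The class in `Ext` of a cocycle of `Hom(P, Y)`, as a linear map. -/
def cocycleToExt (n : ℕ) :
    LinearMap.ker (((P.complex.linearYonedaObj A Y).sc n).g.hom) →ₗ[A] Abelian.Ext X Y n where
  toFun f := P.extMk f.1 (n + 1) rfl ((mem_ker_sc_linearYonedaObj P n f.1).1 f.2)
  map_add' f g := (P.add_extMk _ _ _ _ _ _).symm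
  map_smul' r f := by
    have := P.extMk_comp_mk₀ f.1 (n + 1) rfl ((mem_ker_sc_linearYonedaObj P n f.1).1 f.2)
      (r • 𝟙 Y)
    rw [← Abelian.Ext.smul_eq_comp_mk₀] at this
    refine Eq.trans ?_ this.symm
    congr 1

lemma cocycleToExt_surjective (n : ℕ) :
    Function.Surjective (cocycleToExt (Y := Y) P n) := fun α => by
  obtain ⟨f, hf, h⟩ := P.extMk_surjective α (n + 1) rfl
  exact ⟨⟨f, (mem_ker_sc_linearYonedaObj P n f).2 hf⟩, h⟩

lemma ker_cocycleToExt (n : ℕ) :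
    LinearMap.ker (cocycleToExt (Y := Y) P n) =
      LinearMap.range ((P.complex.linearYonedaObj A Y).sc n).moduleCatToCycles := by
  have aux : ∀ f, f ∈ LinearMap.range
      ((P.complex.linearYonedaObj A Y).sc n).moduleCatToCycles ↔
      f.1 ∈ LinearMap.range (((P.complex.linearYonedaObj A Y).sc n).f.hom) := fun f =>
    ⟨fun ⟨g, hg⟩ => ⟨g, congrArg Subtype.val hg⟩, fun ⟨g, hg⟩ => ⟨g, Subtype.ext hg⟩⟩
  ext f
  rw [aux]
  cases n with
  | zero =>
    exact (P.extMk_zero_eq_zero_iff f.1 ((mem_ker_sc_linearYonedaObj P 0 f.1).1 f.2)).trans (mem_range_sc_linearYonedaObj_zero P f.1).symm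
  | succ n =>
    exact (P.extMk_eq_zero_iff f.1 _ rfl ((mem_ker_sc_linearYonedaObj P _ f.1).1 f.2) n rfl).trans
      (mem_range_sc_linearYonedaObj_succ P n f.1).symm

/-- The two models of `Ext` of modules agree. -/
def ext1Equiv (n : ℕ) (M N : Type) [AddCommGroup M] [Module A M]
    [AddCommGroup N] [Module A N] :
    ext1 A n M N ≃ₗ[A] Abelian.Ext (ModuleCat.of A M) (ModuleCat.of A N) n :=
  let P := projectiveResolution (ModuleCat.of A M)
  ((P.isoExt n (ModuleCat.of A N)) ≪≫
    ((P.complex.linearYonedaObj A (ModuleCat.of A N)).sc n).moduleCatHomologyIso).toLinearEquiv ≪≫ₗ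
  (Submodule.quotEquivOfEq _ _ (ker_cocycleToExt P n).symm ≪≫ₗ
    (cocycleToExt P n).quotKerEquivOfSurjective (cocycleToExt_surjective P n))

end ExtComparison

noncomputable section ModuleExt

variable {A : Type} [CommRing A]

/-- `Ext^n_A(M, N)` for modules `M` and `N`. -/
abbrev ModExt (A : Type) [CommRing A] (n : ℕ) (M N : Type) [AddCommGroup M] [Module A M]
    [AddCommGroup N] [Module A N] : Type :=
  Abelian.Ext (ModuleCat.of A M) (ModuleCat.of A N) n

lemma subsingleton_of_exact {U V W : Type*} [AddCommGroup U] [AddCommGroup V] [AddCommGroup W]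
    [Module A U] [Module A V] [Module A W] {f : U →ₗ[A] V} {g : V →ₗ[A] W}
    (h : Function.Exact f g) [Subsingleton U] [Subsingleton W] : Subsingleton V := by
  refine subsingleton_of_forall_eq 0 fun v => ?_
  obtain ⟨u, rfl⟩ := (h v).1 (Subsingleton.elim _ _)
  rw [Subsingleton.elim u 0, map_zero]

namespace ModExt

variable {M M' M'' N N' N'' : Type} [AddCommGroup M] [Module A M] [AddCommGroup M'] [Module A M']
  [AddCommGroup M''] [Module A M''] [AddCommGroup N] [Module A N] [AddCommGroup N'] [Module A N']
  [AddCommGroup N''] [Module A N'']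

/-- Contravariant functoriality of `Ext`. -/
def pre (n : ℕ) (N : Type) [AddCommGroup N] [Module A N] (f : M →ₗ[A] M') :
    ModExt A n M' N →ₗ[A] ModExt A n M N :=
  (Abelian.Ext.mk₀ (ModuleCat.ofHom f)).precompOfLinear A (ModuleCat.of A N) (zero_add n)

/-- Covariant functoriality of `Ext`. -/
def post (n : ℕ) (M : Type) [AddCommGroup M] [Module A M] (g : N →ₗ[A] N') :
    ModExt A n M N →ₗ[A] ModExt A n M N' :=
  (Abelian.Ext.mk₀ (ModuleCat.ofHom g)).postcompOfLinear A (ModuleCat.of A M) (add_zero n)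

lemma pre_apply (n : ℕ) (f : M →ₗ[A] M') (e : ModExt A n M' N) :
    pre n N f e = (Abelian.Ext.mk₀ (ModuleCat.ofHom f)).comp e (zero_add n) := rfl

lemma post_apply (n : ℕ) (g : N →ₗ[A] N') (e : ModExt A n M N) :
    post n M g e = e.comp (Abelian.Ext.mk₀ (ModuleCat.ofHom g)) (add_zero n) := rfl

lemma pre_comp (n : ℕ) (f : M →ₗ[A] M') (g : M' →ₗ[A] M'') (e : ModExt A n M'' N) :
    pre n N (g ∘ₗ f) e = pre n N f (pre n N g e) := by
  simp [pre_apply, ModuleCat.ofHom_comp]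

lemma post_comp (n : ℕ) (f : N →ₗ[A] N') (g : N' →ₗ[A] N'') (e : ModExt A n M N) :
    post n M (g ∘ₗ f) e = post n M g (post n M f e) := by
  simp [post_apply, ModuleCat.ofHom_comp]

lemma pre_id (n : ℕ) (e : ModExt A n M N) : pre n N LinearMap.id e = e := by
  simp [pre_apply]

lemma post_id (n : ℕ) (e : ModExt A n M N) : post n M LinearMap.id e = e := by
  simp [post_apply]

lemma pre_smul_id (n : ℕ) (r : A) (e : ModExt A n M N) :
    pre n N (r • LinearMap.id) e = r • e := by
  rw [pre_apply, show ModuleCat.ofHom (r • (LinearMap.id : M →ₗ[A] M)) = r • 𝟙 _ from rfl, Abelian.Ext.mk₀_smul, Abelian.Ext.smul_comp]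
  simp

lemma post_smul_id (n : ℕ) (r : A) (e : ModExt A n M N) :
    post n M (r • LinearMap.id) e = r • e := by
  rw [post_apply, show ModuleCat.ofHom (r • (LinearMap.id : N →ₗ[A] N)) = r • 𝟙 _ from rfl, Abelian.Ext.mk₀_smul, Abelian.Ext.comp_smul]
  simp

lemma pre_zero (n : ℕ) (e : ModExt A n M' N) : pre n N (0 : M →ₗ[A] M') e = 0 := by
  simp [pre_apply]

lemma post_zero (n : ℕ) (e : ModExt A n M N) : post n M (0 : N →ₗ[A] N') e = 0 := by
  simp [post_apply]

/-- Isomorphism invariance of `Ext` in the first variable. -/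
def preEquiv (n : ℕ) (N : Type) [AddCommGroup N] [Module A N] (f : M ≃ₗ[A] M') :
    ModExt A n M' N ≃ₗ[A] ModExt A n M N :=
  LinearEquiv.ofLinearMap (pre n N f) (pre n N f.symm)
    (by ext1 e; simp [← pre_comp, pre_id]) (by ext1 e; simp [← pre_comp, pre_id])

/-- Isomorphism invariance of `Ext` in the second variable. -/
def postEquiv (n : ℕ) (M : Type) [AddCommGroup M] [Module A M] (f : N ≃ₗ[A] N') :
    ModExt A n M N ≃ₗ[A] ModExt A n M N' :=
  LinearEquiv.ofLinearMap (post n M f) (post n M f.symm)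
    (by ext1 e; simp [← post_comp, post_id]) (by ext1 e; simp [← post_comp, post_id])

/-- Homomorphisms are extensions of degree `0`. -/
def ofHom : (M →ₗ[A] N) ≃ₗ[A] ModExt A 0 M N :=
  (ModuleCat.homLinearEquiv (S := A) (M := ModuleCat.of A M) (N := ModuleCat.of A N)).symm ≪≫ₗ
    (Abelian.Ext.linearEquiv₀ (R := A) (X := ModuleCat.of A M) (Y := ModuleCat.of A N)).symm

lemma ofHom_apply (h : M →ₗ[A] N) :
    ofHom h = (Abelian.Ext.mk₀ (ModuleCat.ofHom h) : ModExt A 0 M N) := rfl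

lemma pre_ofHom (f : M →ₗ[A] M') (h : M' →ₗ[A] N) :
    pre 0 N f (ofHom h) = ofHom (h ∘ₗ f) := by
  simp [pre_apply, ofHom_apply]

lemma post_ofHom (g : N →ₗ[A] N') (h : M →ₗ[A] N) :
    post 0 M g (ofHom h) = ofHom (g ∘ₗ h) := by
  simp [post_apply, ofHom_apply]

lemma shortExact {f : M →ₗ[A] M'} {g : M' →ₗ[A] M''} (hf : Function.Injective f)
    (hfg : Function.Exact f g) (hg : Function.Surjective g) :
    (ShortComplex.mk (ModuleCat.ofHom f) (ModuleCat.ofHom g)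
      (by ext x; exact hfg.apply_apply_eq_zero x)).ShortExact where
  exact := (ShortComplex.ShortExact.moduleCat_exact_iff_function_exact _).2 hfg
  mono_f := (ModuleCat.mono_iff_injective _).2 hf
  epi_g := (ModuleCat.epi_iff_surjective _).2 hg

section LES

variable {f : M →ₗ[A] M'} {g : M' →ₗ[A] M''} (hf : Function.Injective f)
    (hfg : Function.Exact f g) (hg : Function.Surjective g)
include hf hfg hg

lemma pre_exact (n : ℕ) (N : Type) [AddCommGroup N] [Module A N] :
    Function.Exact (pre n N g) (pre n N f) := fun e => by
  refine ⟨fun h => Abelian.Ext.contravariant_sequence_exact₂ (shortExact hf hfg hg) _ e h, ?_⟩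
  rintro ⟨e, rfl⟩
  rw [← pre_comp, hfg.linearMap_comp_eq_zero, pre_zero]

lemma post_exact (n : ℕ) (N : Type) [AddCommGroup N] [Module A N] :
    Function.Exact (post n N f) (post n N g) := fun e => by
  refine ⟨fun h => Abelian.Ext.covariant_sequence_exact₂ _ (shortExact hf hfg hg) e h, ?_⟩
  rintro ⟨e, rfl⟩
  rw [← post_comp, hfg.linearMap_comp_eq_zero, post_zero]

lemma exists_pre_delta (n : ℕ) (N : Type) [AddCommGroup N] [Module A N] :
    ∃ δ : ModExt A n M N →ₗ[A] ModExt A (n + 1) M'' N,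
      Function.Exact (pre n N f) δ ∧ Function.Exact δ (pre (n + 1) N g) := by
  refine ⟨(shortExact hf hfg hg).extClass.precompOfLinear A _ (add_comm 1 n),
    fun e => ⟨fun h => Abelian.Ext.contravariant_sequence_exact₁ (shortExact hf hfg hg) _ e
      (add_comm 1 n) h, ?_⟩, fun e => ⟨fun h => Abelian.Ext.contravariant_sequence_exact₃
      (shortExact hf hfg hg) _ e h (add_comm 1 n), ?_⟩⟩
  · rintro ⟨e, rfl⟩
    exact (shortExact hf hfg hg).extClass_comp_assoc e (h := add_comm 1 n)
  · rintro ⟨e, rfl⟩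
    exact (shortExact hf hfg hg).comp_extClass_assoc e (add_comm 1 n)

lemma exists_post_delta (n : ℕ) (N : Type) [AddCommGroup N] [Module A N] :
    ∃ δ : ModExt A n N M'' →ₗ[A] ModExt A (n + 1) N M,
      Function.Exact (post n N g) δ ∧ Function.Exact δ (post (n + 1) N f) := by
  refine ⟨(shortExact hf hfg hg).extClass.postcompOfLinear A _ rfl,
    fun e => ⟨fun h => Abelian.Ext.covariant_sequence_exact₃ _ (shortExact hf hfg hg) e
      rfl h, ?_⟩, fun e => ⟨fun h => Abelian.Ext.covariant_sequence_exact₁ _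
      (shortExact hf hfg hg) e h rfl, ?_⟩⟩
  · rintro ⟨e, rfl⟩
    exact (Abelian.Ext.comp_assoc_of_second_deg_zero _ _ _ rfl).trans
      (by rw [(shortExact hf hfg hg).comp_extClass, Abelian.Ext.comp_zero])
  · rintro ⟨e, rfl⟩
    exact (Abelian.Ext.comp_assoc_of_third_deg_zero _ _ _ rfl).trans
      (by rw [(shortExact hf hfg hg).extClass_comp, Abelian.Ext.comp_zero])

lemma subsingleton_pre_mid {n : ℕ} {N : Type} [AddCommGroup N] [Module A N]
    (h₁ : Subsingleton (ModExt A n M N)) (h₃ : Subsingleton (ModExt A n M'' N)) :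
    Subsingleton (ModExt A n M' N) :=
  subsingleton_of_exact (pre_exact hf hfg hg n N)

lemma subsingleton_pre_left {n : ℕ} {N : Type} [AddCommGroup N] [Module A N]
    (h₂ : Subsingleton (ModExt A n M' N)) (h₃ : Subsingleton (ModExt A (n + 1) M'' N)) :
    Subsingleton (ModExt A n M N) :=
  subsingleton_of_exact (exists_pre_delta hf hfg hg n N).choose_spec.1

lemma subsingleton_pre_right {n : ℕ} {N : Type} [AddCommGroup N] [Module A N]
    (h₁ : Subsingleton (ModExt A n M N)) (h₂ : Subsingleton (ModExt A (n + 1) M' N)) :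
    Subsingleton (ModExt A (n + 1) M'' N) :=
  subsingleton_of_exact (exists_pre_delta hf hfg hg n N).choose_spec.2

lemma subsingleton_post_mid {n : ℕ} {N : Type} [AddCommGroup N] [Module A N]
    (h₁ : Subsingleton (ModExt A n N M)) (h₃ : Subsingleton (ModExt A n N M'')) :
    Subsingleton (ModExt A n N M') :=
  subsingleton_of_exact (post_exact hf hfg hg n N)

lemma subsingleton_post_right {n : ℕ} {N : Type} [AddCommGroup N] [Module A N]
    (h₂ : Subsingleton (ModExt A n N M')) (h₁ : Subsingleton (ModExt A (n + 1) N M)) :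
    Subsingleton (ModExt A n N M'') :=
  subsingleton_of_exact (exists_post_delta hf hfg hg n N).choose_spec.1

lemma subsingleton_post_left {n : ℕ} {N : Type} [AddCommGroup N] [Module A N]
    (h₃ : Subsingleton (ModExt A n N M'')) (h₂ : Subsingleton (ModExt A (n + 1) N M')) :
    Subsingleton (ModExt A (n + 1) N M) :=
  subsingleton_of_exact (exists_post_delta hf hfg hg n N).choose_spec.2

end LES

lemma post_zero_injective {f : N →ₗ[A] N'} (hf : Function.Injective f) :
    Function.Injective (post 0 M f) := by
  rw [injective_iff_map_eq_zero]
  intro e he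
  obtain ⟨h, rfl⟩ := ofHom.surjective e
  rw [post_ofHom, map_eq_zero_iff _ ofHom.injective] at he
  rw [map_eq_zero_iff _ ofHom.injective]
  ext x
  exact hf (by simpa using LinearMap.congr_fun he x)

lemma subsingleton_post_zero {f : N →ₗ[A] N'} (hf : Function.Injective f)
    (h : Subsingleton (ModExt A 0 M N')) : Subsingleton (ModExt A 0 M N) :=
  (post_zero_injective hf).subsingleton

lemma pre_zero_injective {f : M →ₗ[A] M'} (hf : Function.Surjective f) :
    Function.Injective (pre 0 N f) := by
  rw [injective_iff_map_eq_zero]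
  intro e he
  obtain ⟨h, rfl⟩ := ofHom.surjective e
  rw [pre_ofHom, map_eq_zero_iff _ ofHom.injective] at he
  rw [map_eq_zero_iff _ ofHom.injective]
  ext x
  obtain ⟨x, rfl⟩ := hf x
  exact LinearMap.congr_fun he x

lemma subsingleton_zero_iff :
    Subsingleton (ModExt A 0 M N) ↔ Subsingleton (M →ₗ[A] N) :=
  ofHom.toEquiv.subsingleton_congr.symm

lemma subsingleton_projective [Module.Projective A M] (n : ℕ) :
    Subsingleton (ModExt A (n + 1) M N) :=
  haveI : Projective (ModuleCat.of A M) := (IsProjective.iff_projective _).1 inferInstance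
  Abelian.Ext.subsingleton_of_projective _ _ _

lemma subsingleton_left [Subsingleton M] (n : ℕ) : Subsingleton (ModExt A n M N) :=
  ⟨fun a b => by rw [← pre_id n a, ← pre_id n b, Subsingleton.elim LinearMap.id 0, pre_zero,
    pre_zero]⟩

lemma smul_eq_zero_left {n : ℕ} {r : A} (hr : r ∈ Module.annihilator A M) (e : ModExt A n M N) :
    r • e = 0 := by
  rw [← pre_smul_id, show r • (LinearMap.id : M →ₗ[A] M) = 0 from
    LinearMap.ext fun x => Module.mem_annihilator.1 hr x, pre_zero]

instance finite [IsNoetherianRing A] [Module.Finite A M] [Module.Finite A N] (n : ℕ) :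
    Module.Finite A (ModExt A n M N) :=
  ModuleCat.finite_ext A _ _ n

end ModExt
end ModuleExt

noncomputable section Depth

namespace ModExt

variable {A : Type} [CommRing A] {M N N' : Type} [AddCommGroup M] [Module A M]
  [AddCommGroup N] [Module A N] [AddCommGroup N'] [Module A N']

lemma post_add (n : ℕ) (f g : N →ₗ[A] N') (e : ModExt A n M N) :
    post n M (f + g) e = post n M f e + post n M g e := by
  rw [post_apply, show ModuleCat.ofHom (f + g) = ModuleCat.ofHom f + ModuleCat.ofHom g from rfl,
    Abelian.Ext.mk₀_add, Abelian.Ext.comp_add]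
  rfl

lemma post_sum {ι : Type} (s : Finset ι) (n : ℕ) (f : ι → N →ₗ[A] N') (e : ModExt A n M N) :
    post n M (∑ i ∈ s, f i) e = ∑ i ∈ s, post n M (f i) e := by
  classical
  induction s using Finset.induction_on with
  | empty => simp [post_zero]
  | insert i s hi ih => rw [Finset.sum_insert hi, Finset.sum_insert hi, post_add, ih]

lemma subsingleton_pi {ι : Type} [Fintype ι] {n : ℕ} (h : Subsingleton (ModExt A n M N)) :
    Subsingleton (ModExt A n M (ι → N)) := by
  classical
  refine subsingleton_of_forall_eq 0 fun e => ?_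
  have hid : (LinearMap.id : (ι → N) →ₗ[A] (ι → N)) =
      ∑ i, LinearMap.single A (fun _ => N) i ∘ₗ LinearMap.proj i := by
    refine LinearMap.ext fun x => ?_
    simp [LinearMap.sum_apply, Finset.univ_sum_single]
  rw [← post_id n e, hid, post_sum]
  refine Finset.sum_eq_zero fun i _ => ?_
  rw [post_comp, Subsingleton.elim (post n M (LinearMap.proj i) e) 0, map_zero]

end ModExt

open Pointwise in
lemma exact_smul_mkQ {A : Type} [CommRing A] (x : A) (N : Type) [AddCommGroup N] [Module A N] :
    Function.Exact (x • (LinearMap.id : N →ₗ[A] N))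
      (Submodule.mkQ (x • (⊤ : Submodule A N))) := by
  rw [LinearMap.exact_iff, Submodule.ker_mkQ]
  ext y
  simp [Submodule.mem_smul_pointwise_iff_exists]

section Local

variable {A : Type} [CommRing A] [IsLocalRing A]

/-- `depth N ≥ t`, in terms of the vanishing of `Ext^m(k, N)` for `m < t`. -/
def DepthGE (A : Type) [CommRing A] [IsLocalRing A] (t : ℕ) (N : Type) [AddCommGroup N]
    [Module A N] : Prop :=
  ∀ m < t, Subsingleton (ModExt A m (IsLocalRing.ResidueField A) N)

lemma natCast_le_rdepth_iff (t : ℕ) (N : Type) [AddCommGroup N] [Module A N] :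
    (t : ℕ∞) ≤ rdepth A N ↔ DepthGE A t N := by
  rw [rdepth, le_sInf_iff]
  refine ⟨fun h m hm => ?_, ?_⟩
  · by_contra hs
    have := h m ⟨m, rfl, fun h => hs ((ext1Equiv m _ N).symm.toEquiv.subsingleton)⟩
    exact absurd (Nat.cast_le.1 this) (by lia)
  · rintro h _ ⟨m, rfl, hm⟩
    by_contra hlt
    exact hm (haveI := h m (by simpa using hlt); (ext1Equiv m _ N).toEquiv.subsingleton)

lemma isMCM_iff (d : ℕ) (N : Type) [AddCommGroup N] [Module A N] :
    IsMCM A d N ↔ Module.Finite A N ∧ DepthGE A d N := by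
  rw [IsMCM, natCast_le_rdepth_iff]

namespace DepthGE

variable {M N P : Type} [AddCommGroup M] [Module A M]
  [AddCommGroup N] [Module A N] [AddCommGroup P] [Module A P]

lemma mono {s t : ℕ} (h : DepthGE A t N) (hst : s ≤ t) : DepthGE A s N :=
  fun m hm => h m (by lia)

lemma of_equiv {t : ℕ} (e : M ≃ₗ[A] N) (h : DepthGE A t M) : DepthGE A t N :=
  fun m hm => haveI := h m hm; (ModExt.postEquiv m _ e).symm.toEquiv.subsingleton

lemma pi {ι : Type} [Fintype ι] {t : ℕ} (h : DepthGE A t N) : DepthGE A t (ι → N) :=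
  fun m hm => ModExt.subsingleton_pi (h m hm)

variable {f : M →ₗ[A] N} {g : N →ₗ[A] P} 

lemma left {t : ℕ} (hf : Function.Injective f)
    (hfg : Function.Exact f g) (hg : Function.Surjective g)
    (hN : DepthGE A (t + 1) N) (hP : DepthGE A t P) : DepthGE A (t + 1) M
  | 0, hm => ModExt.subsingleton_post_zero hf (hN 0 hm)
  | m + 1, hm => ModExt.subsingleton_post_left hf hfg hg (hP m (by lia)) (hN _ hm)

lemma mid {t : ℕ} (hf : Function.Injective f)
    (hfg : Function.Exact f g) (hg : Function.Surjective g)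
    (hM : DepthGE A t M) (hP : DepthGE A t P) : DepthGE A t N :=
  fun m hm => ModExt.subsingleton_post_mid hf hfg hg (hM m hm) (hP m hm)

lemma right {t : ℕ} (hf : Function.Injective f)
    (hfg : Function.Exact f g) (hg : Function.Surjective g)
    (hM : DepthGE A (t + 1) M) (hN : DepthGE A t N) : DepthGE A t P :=
  fun m hm => ModExt.subsingleton_post_right hf hfg hg (hN m hm) (hM _ (by lia))

lemma prod {t : ℕ} (hM : DepthGE A t M) (hN : DepthGE A t N) : DepthGE A t (M × N) :=
  mid (f := LinearMap.inl A M N) (g := LinearMap.snd A M N) LinearMap.inl_injective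
    .inl_snd LinearMap.snd_surjective hM hN

/-- A kernel of a map between modules of depth at least `t` has depth at least `min 2 t`. -/
lemma ker {s t : ℕ} (φ : M →ₗ[A] N) (hM : DepthGE A t M) (hN : DepthGE A t N) (hs : s ≤ 2)
    (hst : s ≤ t) : DepthGE A s (LinearMap.ker φ) := by
  rcases s with _ | s
  · intro m hm; lia
  refine left (LinearMap.ker φ).subtype_injective
    (g := φ.rangeRestrict) (fun x => ?_) φ.surjective_rangeRestrict (hM.mono hst) ?_
  · simp [← LinearMap.mem_ker]
  · intro m hm
    obtain rfl : m = 0 := by lia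
    exact ModExt.subsingleton_post_zero (LinearMap.range φ).subtype_injective (hN 0 (by lia))

lemma quotSMulTop {t : ℕ} {x : A} (h : DepthGE A (t + 1) N) (hx : IsSMulRegular N x) :
    DepthGE A t (QuotSMulTop x N) :=
  right (f := x • LinearMap.id) (g := Submodule.mkQ _) (fun _ _ e => hx e)
    (exact_smul_mkQ x N) (Submodule.mkQ_surjective _) h (h.mono (by lia))

lemma exists_isSMulRegular [IsNoetherianRing A] [Module.Finite A N] {t : ℕ}
    (h : DepthGE A (t + 1) N) : ∃ x ∈ IsLocalRing.maximalIdeal A, IsSMulRegular N x := by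
  have := ModExt.subsingleton_zero_iff.1 (h 0 (by lia))
  obtain ⟨x, hx, h⟩ := IsSMulRegular.subsingleton_linearMap_iff.1 this
  exact ⟨x, (Ideal.annihilator_quotient (I := IsLocalRing.maximalIdeal A)).le hx, h⟩

end DepthGE

lemma ModExt.subsingleton_of_smul_surjective [IsNoetherianRing A] {n : ℕ} {M N : Type}
    [AddCommGroup M] [Module A M] [Module.Finite A M] [AddCommGroup N] [Module A N]
    [Module.Finite A N] {x : A} (hx : x ∈ IsLocalRing.maximalIdeal A)
    (h : ∀ e : ModExt A n M N, ∃ e', x • e' = e) : Subsingleton (ModExt A n M N) := by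
  have := Submodule.eq_bot_of_le_smul_of_le_jacobson_bot (IsLocalRing.maximalIdeal A)
    (⊤ : Submodule A (ModExt A n M N)) Module.Finite.fg_top (fun e _ => by
      obtain ⟨e', rfl⟩ := h e
      exact Submodule.smul_mem_smul hx trivial) (IsLocalRing.maximalIdeal_le_jacobson _)
  exact (Submodule.subsingleton_iff A).1 (subsingleton_of_bot_eq_top this.symm)

end Local
end Depth

noncomputable section InjectiveDimension

open IsLocalRing RingTheory.Sequence

/-- `Ext^j(-, Z)` vanishes on finite modules for `j > s`. -/
def InjDimLE (A : Type) [CommRing A] (s : ℕ) (Z : Type) [AddCommGroup Z] [Module A Z] : Prop :=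
  ∀ (N : Type) [AddCommGroup N] [Module A N] [Module.Finite A N] (j : ℕ), s < j →
    Subsingleton (ModExt A j N Z)

variable {A : Type} [CommRing A]

open Pointwise in
lemma exists_quotSMulTop_delta {x : A} {N : Type} [AddCommGroup N] [Module A N]
    (hx : IsSMulRegular N x) (n : ℕ) (Z : Type) [AddCommGroup Z] [Module A Z] :
    ∃ δ : ModExt A n N Z →ₗ[A] ModExt A (n + 1) (QuotSMulTop x N) Z,
      (∀ e, δ e = 0 ↔ ∃ e', x • e' = e) ∧
      Function.Exact δ (ModExt.pre (n + 1) Z (Submodule.mkQ (x • (⊤ : Submodule A N)))) := by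
  obtain ⟨δ, h₁, h₂⟩ := ModExt.exists_pre_delta (f := x • LinearMap.id) (fun _ _ e => hx e)
    (exact_smul_mkQ x N) (Submodule.mkQ_surjective _) n Z
  refine ⟨δ, fun e => (h₁ e).trans ?_, h₂⟩
  simp only [Set.mem_range, ModExt.pre_smul_id]

lemma ModExt.subsingleton_quotSMulTop {x : A} {N : Type} [AddCommGroup N] [Module A N]
    (hx : IsSMulRegular N x) {n : ℕ} {Z : Type} [AddCommGroup Z] [Module A Z]
    (h₁ : Subsingleton (ModExt A n N Z)) (h₂ : Subsingleton (ModExt A (n + 1) N Z)) :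
    Subsingleton (ModExt A (n + 1) (QuotSMulTop x N) Z) :=
  ModExt.subsingleton_pre_right (f := x • LinearMap.id) (fun _ _ e => hx e)
    (exact_smul_mkQ x N) (Submodule.mkQ_surjective _) h₁ h₂

lemma isSMulRegular_quotient_prime (p : PrimeSpectrum A) {x : A} (hx : x ∉ p.1) :
    IsSMulRegular (A ⧸ p.1) x := by
  rw [isSMulRegular_iff_right_eq_zero_of_smul]
  intro y hy
  rw [Algebra.smul_def, mul_eq_zero] at hy
  exact hy.resolve_left fun h => hx (Ideal.Quotient.eq_zero_iff_mem.1 h)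

open Pointwise in
lemma nonempty_ext_quotient_weaklyRegular {Z : Type} [AddCommGroup Z] [Module A Z]
    (rs : List A) : ∀ {N : Type} [AddCommGroup N] [Module A N] {c : ℕ}
      (_ : ∀ j, c < j → Subsingleton (ModExt A j N Z)) (_ : IsWeaklyRegular N rs),
      (∀ j, c + rs.length < j →
        Subsingleton (ModExt A j (N ⧸ (Ideal.ofList rs • ⊤ : Submodule A N)) Z)) ∧
      Nonempty (ModExt A (c + rs.length) (N ⧸ (Ideal.ofList rs • ⊤ : Submodule A N)) Z ≃ₗ[A]
        ModExt A c N Z ⧸ (Ideal.ofList rs • ⊤ : Submodule A (ModExt A c N Z))) := by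
  induction rs with
  | nil =>
    intro N _ _ c h _
    have e (Q : Type) [AddCommGroup Q] [Module A Q] :
        (Q ⧸ (Ideal.ofList ([] : List A) • ⊤ : Submodule A Q)) ≃ₗ[A] Q :=
      Submodule.quotEquivOfEqBot _ (by simp)
    refine ⟨fun j hj => ?_, ⟨(ModExt.preEquiv c Z (e N)).symm ≪≫ₗ (e _).symm⟩⟩
    have := h j hj
    exact (ModExt.preEquiv j Z (e N)).symm.toEquiv.subsingleton
  | cons r rs ih =>
    intro N _ _ c h hr
    rw [isWeaklyRegular_cons_iff] at hr
    have h' : ∀ j, c + 1 < j → Subsingleton (ModExt A j (QuotSMulTop r N) Z) := by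
      rintro (_ | j) hj
      · lia
      · exact ModExt.subsingleton_quotSMulTop hr.1 (h _ (by lia)) (h _ (by lia))
    obtain ⟨hv, ⟨E⟩⟩ := ih h' hr.2
    have hlen : c + (r :: rs).length = c + 1 + rs.length := by simp; lia
    rw [hlen]
    have e := Submodule.quotOfListConsSMulTopEquivQuotSMulTopInner N r rs
    refine ⟨fun j hj => ?_, ?_⟩
    · have := hv j hj
      exact (ModExt.preEquiv j Z e).symm.toEquiv.subsingleton
    · obtain ⟨δ, h₁, h₂⟩ := exists_quotSMulTop_delta hr.1 c Z
      have hδ : Function.Surjective δ := fun y => (h₂ y).1 (by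
        have := h (c + 1) (by lia)
        exact Subsingleton.elim _ _)
      have hk : LinearMap.ker δ = r • ⊤ := by
        ext y
        simp [h₁, Submodule.mem_smul_pointwise_iff_exists]
      let e₂ : QuotSMulTop r (ModExt A c N Z) ≃ₗ[A] ModExt A (c + 1) (QuotSMulTop r N) Z :=
        Submodule.quotEquivOfEq _ _ hk.symm ≪≫ₗ δ.quotKerEquivOfSurjective hδ
      exact ⟨(ModExt.preEquiv _ Z e).symm ≪≫ₗ E ≪≫ₗ
        Submodule.Quotient.equiv _ _ e₂.symm (by
          rw [Submodule.map_smul'', Submodule.map_top, LinearEquiv.range]) ≪≫ₗ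
        (Submodule.quotOfListConsSMulTopEquivQuotSMulTopInner _ r rs).symm⟩

variable [IsNoetherianRing A]

lemma ModExt.subsingleton_of_primes {j : ℕ} {Z : Type} [AddCommGroup Z] [Module A Z]
    (h : ∀ p : PrimeSpectrum A, Subsingleton (ModExt A j (A ⧸ p.1) Z))
    (N : Type) [AddCommGroup N] [Module A N] [Module.Finite A N] :
    Subsingleton (ModExt A j N Z) := by
  refine IsNoetherianRing.induction_on_isQuotientEquivQuotientPrime A (M := N) inferInstance
    (motive := fun N _ _ _ => Subsingleton (ModExt A j N Z)) ?_ ?_ ?_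
  · intro N _ _ _ _
    exact ModExt.subsingleton_left j
  · intro N _ _ _ p e
    have := h p
    exact (ModExt.preEquiv j Z e).symm.toEquiv.subsingleton
  · intro N₁ _ _ _ N₂ _ _ _ N₃ _ _ _ f g hf hg hfg h₁ h₃
    exact ModExt.subsingleton_pre_mid hf hfg hg h₁ h₃

variable [IsLocalRing A]

lemma ModExt.subsingleton_of_quotSMulTop {x : A} (hm : x ∈ maximalIdeal A) {N : Type}
    [AddCommGroup N] [Module A N] [Module.Finite A N] (hx : IsSMulRegular N x) {n : ℕ} {Z : Type}
    [AddCommGroup Z] [Module A Z] [Module.Finite A Z]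
    (h : Subsingleton (ModExt A (n + 1) (QuotSMulTop x N) Z)) :
    Subsingleton (ModExt A n N Z) := by
  obtain ⟨δ, h₁, -⟩ := exists_quotSMulTop_delta hx n Z
  exact ModExt.subsingleton_of_smul_surjective hm fun e => (h₁ e).1 (Subsingleton.elim _ _)

lemma exists_isWeaklyRegular (n t : ℕ) : ∀ {N N' : Type} [AddCommGroup N] [Module A N]
    [Module.Finite A N] [AddCommGroup N'] [Module A N'] [Module.Finite A N']
    (_ : DepthGE A t N) (_ : DepthGE A t N'),
    ∃ rs : List A, rs.length = t ∧ (∀ r ∈ rs, r ∈ maximalIdeal A ^ n) ∧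
      IsWeaklyRegular N rs ∧ IsWeaklyRegular N' rs := by
  induction t with
  | zero => exact fun _ _ => ⟨[], rfl, by simp, .nil _ _, .nil _ _⟩
  | succ t ih =>
    intro N N' _ _ _ _ _ _ h h'
    obtain ⟨x, hm, hx⟩ := (h.prod h').exists_isSMulRegular
    have h₁ : IsSMulRegular N (x ^ n) := .pow n fun a b e =>
      congrArg Prod.fst (hx (a₁ := (a, 0)) (a₂ := (b, 0)) (by simpa using e))
    have h₂ : IsSMulRegular N' (x ^ n) := .pow n fun a b e =>
      congrArg Prod.snd (hx (a₁ := (0, a)) (a₂ := (0, b)) (by simpa using e))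
    obtain ⟨rs, hl, hrs, r₁, r₂⟩ := ih (h.quotSMulTop h₁) (h'.quotSMulTop h₂)
    refine ⟨x ^ n :: rs, by simp [hl], ?_, .cons h₁ r₁, .cons h₂ r₂⟩
    simpa using ⟨Ideal.pow_mem_pow hm n, hrs⟩

lemma ModExt.subsingleton_of_depthGE {s : ℕ} {Z : Type} [AddCommGroup Z] [Module A Z]
    [Module.Finite A Z] (hZ : InjDimLE A s Z) (t : ℕ) : ∀ {N : Type} [AddCommGroup N] [Module A N]
    [Module.Finite A N] (_ : DepthGE A t N) (j : ℕ), s < j + t →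
    Subsingleton (ModExt A j N Z) := by
  induction t with
  | zero => exact fun {N} _ _ _ _ j hj => hZ N j hj
  | succ t ih =>
    intro N _ _ _ h j hj
    obtain ⟨x, hm, hx⟩ := h.exists_isSMulRegular
    exact ModExt.subsingleton_of_quotSMulTop hm hx (ih (h.quotSMulTop hx) (j + 1) (by lia))

omit [IsLocalRing A] [IsNoetherianRing A] in
lemma mdim_quotient_ideal (I : Ideal A) : mdim A (A ⧸ I) = ringKrullDim (A ⧸ I) := by
  rw [mdim, Ideal.annihilator_quotient]

omit [IsLocalRing A] [IsNoetherianRing A] in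
lemma mdim_le_of_annihilator_le {M N : Type} [AddCommGroup M] [Module A M] [AddCommGroup N]
    [Module A N] (h : Module.annihilator A M ≤ Module.annihilator A N) : mdim A N ≤ mdim A M :=
  ringKrullDim_le_of_surjective (Ideal.Quotient.factor h) (Ideal.Quotient.factor_surjective h)

open Pointwise in
omit [IsLocalRing A] [IsNoetherianRing A] in
lemma mdim_quotSMulTop_add_one_le (p : PrimeSpectrum A) {x : A} (hx : x ∉ p.1) :
    mdim A (QuotSMulTop x (A ⧸ p.1)) + 1 ≤ mdim A (A ⧸ p.1) := by
  rw [mdim_quotient_ideal]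
  have hx' : Ideal.Quotient.mk p.1 x ∈ nonZeroDivisors (A ⧸ p.1) :=
    mem_nonZeroDivisors_of_ne_zero fun h => hx (Ideal.Quotient.eq_zero_iff_mem.1 h)
  refine le_trans ?_ (ringKrullDim_quotient_succ_le_of_nonZeroDivisor hx')
  gcongr
  have hp : p.1 ≤ Module.annihilator A (QuotSMulTop x (A ⧸ p.1)) :=
    (Ideal.annihilator_quotient (I := p.1)).ge.trans
      ((Submodule.mkQ _).annihilator_le_of_surjective (Submodule.mkQ_surjective _))
  refine ringKrullDim_le_of_surjective (Ideal.Quotient.lift (Ideal.span {Ideal.Quotient.mk p.1 x})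
    (Ideal.Quotient.factor hp) ?_)
    (Ideal.Quotient.lift_surjective_of_surjective _ _ (Ideal.Quotient.factor_surjective hp))
  intro a ha
  obtain ⟨b, rfl⟩ := Ideal.mem_span_singleton'.1 ha
  rw [map_mul, Ideal.Quotient.factor_mk, Ideal.Quotient.eq_zero_iff_mem.2, mul_zero]
  refine Module.mem_annihilator.2 fun m => ?_
  obtain ⟨m, rfl⟩ := Submodule.mkQ_surjective _ m
  rw [← map_smul, Submodule.mkQ_apply, Submodule.Quotient.mk_eq_zero]
  exact Submodule.smul_mem_pointwise_smul m x ⊤ trivial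

omit [IsLocalRing A] [IsNoetherianRing A] in
lemma subsingleton_of_mdim_lt_zero {N : Type} [AddCommGroup N] [Module A N]
    (h : mdim A N < (0 : ℕ)) : Subsingleton N := by
  rw [← Module.annihilator_eq_top_iff (R := A), ← Ideal.Quotient.subsingleton_iff]
  by_contra hn
  rw [not_subsingleton_iff_nontrivial] at hn
  exact absurd (ringKrullDim_nonneg_of_nontrivial (R := A ⧸ Module.annihilator A N)) (not_le.2 h)

omit [IsLocalRing A] in
lemma ModExt.subsingleton_of_mdim_lt_of_primes {j : ℕ} {c : WithBot ℕ∞}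
    {Z : Type} [AddCommGroup Z] [Module A Z]
    (h : ∀ p : PrimeSpectrum A, mdim A (A ⧸ p.1) < c → Subsingleton (ModExt A j (A ⧸ p.1) Z))
    (N : Type) [AddCommGroup N] [Module A N] [Module.Finite A N] (hN : mdim A N < c) :
    Subsingleton (ModExt A j N Z) := by
  revert hN
  refine IsNoetherianRing.induction_on_isQuotientEquivQuotientPrime A (M := N) inferInstance
    (motive := fun N _ _ _ => mdim A N < c → Subsingleton (ModExt A j N Z)) ?_ ?_ ?_
  · intro N _ _ _ _ _
    exact ModExt.subsingleton_left j
  · intro N _ _ _ p e hN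
    have := h p (by rwa [mdim, ← e.annihilator_eq])
    exact (ModExt.preEquiv j Z e).symm.toEquiv.subsingleton
  · intro N₁ _ _ _ N₂ _ _ _ N₃ _ _ _ f g hf hg hfg h₁ h₃ hN
    exact ModExt.subsingleton_pre_mid hf hfg hg
      (h₁ ((mdim_le_of_annihilator_le (f.annihilator_le_of_injective hf)).trans_lt hN))
      (h₃ ((mdim_le_of_annihilator_le (g.annihilator_le_of_surjective hg)).trans_lt hN))

/-- Ischebeck's theorem. -/
lemma ModExt.subsingleton_of_mdim_lt {d : ℕ} {Z : Type} [AddCommGroup Z] [Module A Z]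
    [Module.Finite A Z] (hZ : DepthGE A d Z) (c : ℕ) : ∀ (N : Type) [AddCommGroup N] [Module A N]
    [Module.Finite A N] (_ : mdim A N < c) (j : ℕ), j + c ≤ d →
    Subsingleton (ModExt A j N Z) := by
  induction c with
  | zero =>
    intro N _ _ _ hN j _
    have := subsingleton_of_mdim_lt_zero hN
    exact ModExt.subsingleton_left j
  | succ c ih =>
    intro N _ _ _ hN j hj
    refine ModExt.subsingleton_of_mdim_lt_of_primes (c := (c + 1 : ℕ)) (fun p hp => ?_) N hN
    by_cases hpm : p.1 = maximalIdeal A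
    · rw [hpm]
      exact hZ j (by lia)
    obtain ⟨x, hx, hxp⟩ := SetLike.exists_of_lt (lt_of_le_of_ne (le_maximalIdeal p.2.ne_top) hpm)
    refine ModExt.subsingleton_of_quotSMulTop hx (isSMulRegular_quotient_prime p hxp)
      (ih _ ?_ _ (by lia))
    refine lt_of_add_lt_add_right (a := 1) (lt_of_le_of_lt (mdim_quotSMulTop_add_one_le p hxp) ?_)
    exact_mod_cast hp

end InjectiveDimension

noncomputable section CanonicalModule

open IsLocalRing RingTheory.Sequence

variable {A : Type} [CommRing A]

section FiniteLength

variable {M M' M'' Z : Type} [AddCommGroup M] [Module A M] [AddCommGroup M'] [Module A M']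
  [AddCommGroup M''] [Module A M''] [AddCommGroup Z] [Module A Z] {f : M →ₗ[A] M'}
  {g : M' →ₗ[A] M''}

lemma ModExt.pre_injective (hf : Function.Injective f) (hfg : Function.Exact f g)
    (hg : Function.Surjective g) (d : ℕ) (h : ∀ j < d, Subsingleton (ModExt A j M Z)) :
    Function.Injective (ModExt.pre d Z g) := by
  rcases d with _ | d
  · exact ModExt.pre_zero_injective hg
  obtain ⟨δ, -, h₂⟩ := ModExt.exists_pre_delta hf hfg hg d Z
  rw [injective_iff_map_eq_zero]
  intro y hy
  obtain ⟨x, rfl⟩ := (h₂ y).1 hy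
  have := h d (by lia)
  rw [Subsingleton.elim x 0, map_zero]

lemma ModExt.pre_surjective (hf : Function.Injective f) (hfg : Function.Exact f g)
    (hg : Function.Surjective g) (d : ℕ) (h : Subsingleton (ModExt A (d + 1) M'' Z)) :
    Function.Surjective (ModExt.pre d Z f) := by
  obtain ⟨δ, h₁, -⟩ := ModExt.exists_pre_delta hf hfg hg d Z
  exact fun y => (h₁ y).1 (Subsingleton.elim _ _)

variable [IsLocalRing A]

/-- If `Ext^j(k, Z)` vanishes for `j ≠ d` and has length one for `j = d`, then `Ext^d(-, Z)` is an
exact length-preserving functor on modules of finite length. -/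
lemma IsFiniteLength.ext_duality {d : ℕ}
    (hv : ∀ j, j ≠ d → Subsingleton (ModExt A j (ResidueField A) Z))
    (hl : Module.length A (ModExt A d (ResidueField A) Z) = 1) (h : IsFiniteLength A M) :
    (∀ j, j ≠ d → Subsingleton (ModExt A j M Z)) ∧
      Module.length A (ModExt A d M Z) = Module.length A M := by
  induction h with
  | of_subsingleton =>
    refine ⟨fun j _ => ModExt.subsingleton_left j, ?_⟩
    rw [Module.length_eq_zero_iff.2 (ModExt.subsingleton_left d), Module.length_eq_zero]
  | @of_simple_quotient M _ _ N hs _ ih =>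
    obtain ⟨I, hI, ⟨e⟩⟩ := isSimpleModule_iff_quot_maximal.1 hs
    obtain rfl := eq_maximalIdeal hI
    have hex : Function.Exact N.subtype N.mkQ := LinearMap.exact_subtype_mkQ N
    have hq : ∀ j, j ≠ d → Subsingleton (ModExt A j (M ⧸ N) Z) := fun j hj =>
      haveI : Subsingleton (ModExt A j (A ⧸ maximalIdeal A) Z) := hv j hj
      (ModExt.preEquiv j Z e).symm.toEquiv.subsingleton
    refine ⟨fun j hj => ModExt.subsingleton_pre_mid N.subtype_injective hex N.mkQ_surjective
      (ih.1 j hj) (hq j hj), ?_⟩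
    rw [Module.length_eq_add_of_exact (ModExt.pre d Z N.mkQ) (ModExt.pre d Z N.subtype)
      (ModExt.pre_injective N.subtype_injective hex N.mkQ_surjective d
        fun j hj => ih.1 j hj.ne)
      (ModExt.pre_surjective N.subtype_injective hex N.mkQ_surjective d (hq _ (by lia)))
      (ModExt.pre_exact N.subtype_injective hex N.mkQ_surjective d Z), ih.2,
      ← (ModExt.preEquiv d Z e).length_eq, Module.length_eq_add_of_exact N.subtype N.mkQ
        N.subtype_injective N.mkQ_surjective hex, add_comm, e.length_eq]
    congr 1
    have : IsSimpleModule A (A ⧸ maximalIdeal A) := .congr e.symm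
    exact hl.trans (Module.length_eq_one A (A ⧸ maximalIdeal A)).symm

end FiniteLength

variable [IsLocalRing A] [IsNoetherianRing A] {d : ℕ} 

lemma exists_parameter_ideal (hdim : ringKrullDim A = d) (hA : DepthGE A d A) {n : ℕ} (hn : n ≠ 0)
    {N : Type} [AddCommGroup N] [Module A N] [Module.Finite A N] (hN : DepthGE A d N) :
    ∃ rs : List A, rs.length = d ∧ Ideal.ofList rs ≤ maximalIdeal A ^ n ∧
      IsArtinianRing (A ⧸ Ideal.ofList rs) ∧ IsWeaklyRegular A rs ∧ IsWeaklyRegular N rs := by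
  obtain ⟨rs, hl, hrs, h₁, h₂⟩ := exists_isWeaklyRegular n d hA hN
  have hle : Ideal.ofList rs ≤ maximalIdeal A ^ n := Ideal.span_le.2 hrs
  have hm : Ideal.ofList rs ≤ maximalIdeal A := hle.trans (Ideal.pow_le_self hn)
  refine ⟨rs, hl, hle, ?_, h₁, h₂⟩
  have hreg : IsRegular A rs := (IsLocalRing.isRegular_iff_isWeaklyRegular_of_subset_maximalIdeal
    (fun r hr => Ideal.pow_le_self hn (hrs r hr))).2 h₁
  have hsum := ringKrullDim_add_length_eq_ringKrullDim_of_isRegular rs hreg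
  have : Nontrivial (A ⧸ Ideal.ofList rs) :=
    Ideal.Quotient.nontrivial_iff.2 fun h => (maximalIdeal.isMaximal A).ne_top (top_le_iff.1 (h ▸ hm))
  have h0 : ringKrullDim (A ⧸ Ideal.ofList rs) = 0 := by
    refine le_antisymm ?_ ringKrullDim_nonneg_of_nontrivial
    by_contra! hlt
    have h1 : (1 : WithBot ℕ∞) ≤ ringKrullDim (A ⧸ Ideal.ofList rs) := by
      simpa using ENat.WithBot.add_one_le_iff (n := 0).2 hlt
    have h2 : (1 : WithBot ℕ∞) + d ≤ d := by
      rw [hdim, hl] at hsum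
      exact (add_le_add_left h1 _).trans_eq hsum
    have : 1 + d ≤ d := by exact_mod_cast h2
    lia
  have : IsLocalRing (A ⧸ Ideal.ofList rs) := .of_surjective' _ Ideal.Quotient.mk_surjective
  exact (isArtinianRing_iff_isNoetherianRing_krullDimLE_zero).2
    ⟨inferInstance, (ringKrullDimZero_iff_ringKrullDim_eq_zero).2 h0⟩

omit [IsLocalRing A] in
lemma isFiniteLength_of_le_annihilator {I : Ideal A} [IsArtinianRing (A ⧸ I)] {N : Type}
    [AddCommGroup N] [Module A N] [Module.Finite A N] (h : I ≤ Module.annihilator A N) :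
    IsFiniteLength A N := by
  have ht : Module.IsTorsionBySet A N I := fun n a => Module.mem_annihilator.1 (h a.2) n
  let := ht.module
  have : IsScalarTower A (A ⧸ I) N := ht.isScalarTower
  have : Module.Finite (A ⧸ I) N := .of_restrictScalars_finite A _ _
  exact isFiniteLength_iff_isNoetherian_isArtinian.2
    ⟨inferInstance, isArtinian_of_surjective_algebraMap (R := A ⧸ I) Ideal.Quotient.mk_surjective⟩

omit [IsNoetherianRing A] in
lemma exists_residueField_injective (N : Type) [AddCommGroup N] [Module A N] [IsArtinian A N]
    [Nontrivial N] : ∃ f : ResidueField A →ₗ[A] N, Function.Injective f := by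
  obtain ⟨S, hS⟩ := IsAtomic.exists_atom (Submodule A N)
  obtain ⟨I, hI, ⟨e⟩⟩ := isSimpleModule_iff_quot_maximal.1 (isSimpleModule_iff_isAtom.2 hS)
  obtain rfl := eq_maximalIdeal hI
  exact ⟨S.subtype ∘ₗ e.symm.toLinearMap, S.subtype_injective.comp e.symm.injective⟩

variable {ω : Type} [AddCommGroup ω] [Module A ω] [Module.Finite A ω]

omit [IsLocalRing A] [IsNoetherianRing A] in
lemma le_annihilator_quotient_smul_top (I : Ideal A) (N : Type) [AddCommGroup N] [Module A N] :
    I ≤ Module.annihilator A (N ⧸ (I • ⊤ : Submodule A N)) := fun a ha =>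
  Module.mem_annihilator.2 fun q => by
    obtain ⟨b, rfl⟩ := Submodule.mkQ_surjective _ q
    rw [← map_smul, Submodule.mkQ_apply, Submodule.Quotient.mk_eq_zero]
    exact Submodule.smul_mem_smul ha trivial

lemma InjDimLE.dim (hdim : ringKrullDim A = d) (hA : DepthGE A d A) {n : ℕ} 
    (hω : InjDimLE A n ω) : InjDimLE A d ω := by
  suffices h : ∀ m j, n < j + m → d < j → ∀ (N : Type) [AddCommGroup N] [Module A N]
      [Module.Finite A N], Subsingleton (ModExt A j N ω) from
    fun N _ _ _ j hj => h n j (by lia) hj N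
  obtain ⟨rs, hl, hle, hart, hreg, -⟩ := exists_parameter_ideal hdim hA one_ne_zero hA
  rw [pow_one] at hle
  set Q := A ⧸ (Ideal.ofList rs • ⊤ : Submodule A A)
  have hQ : IsFiniteLength A Q := isFiniteLength_of_le_annihilator (I := Ideal.ofList rs)
    (le_annihilator_quotient_smul_top _ _)
  have hQ' : Nontrivial Q := Submodule.Quotient.nontrivial_iff.2 fun h =>
    (maximalIdeal.isMaximal A).ne_top (top_le_iff.1 (h.ge.trans (by simpa using hle)))
  obtain ⟨f, hf⟩ := haveI := (isFiniteLength_iff_isNoetherian_isArtinian.1 hQ).2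
    exists_residueField_injective (A := A) Q
  have hE : ∀ j, d < j → Subsingleton (ModExt A j Q ω) := fun j hj =>
    (nonempty_ext_quotient_weaklyRegular (Z := ω) rs (N := A) (c := 0) (fun j hj => by
      obtain ⟨j, rfl⟩ := Nat.exists_eq_succ_of_ne_zero hj.ne'
      exact ModExt.subsingleton_projective j) hreg).1 j (by lia)
  intro m
  induction m with
  | zero => exact fun j hj _ N => hω N j hj
  | succ m ih =>
    intro j hj hdj N _ _ _
    refine ModExt.subsingleton_of_primes (fun p => ?_) N
    by_cases hpm : p.1 = maximalIdeal A
    · rw [hpm]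
      exact ModExt.subsingleton_pre_left hf (LinearMap.exact_map_mkQ_range f)
        (Submodule.mkQ_surjective _) (hE j hdj) (ih _ (by lia) (by lia) _)
    obtain ⟨x, hx, hxp⟩ := SetLike.exists_of_lt (lt_of_le_of_ne (le_maximalIdeal p.2.ne_top) hpm)
    exact ModExt.subsingleton_of_quotSMulTop hx (isSMulRegular_quotient_prime p hxp)
      (ih _ (by lia) (by lia) _)

section Endomorphism

variable (hω : DepthGE A d ω) (hi : InjDimLE A d ω)
  (hl : Module.length A (ModExt A d (ResidueField A) ω) = 1)

include hω hi hl

omit [IsNoetherianRing A] [Module.Finite A ω] in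
/-- If `Ext^d(-, ω)` is a duality on modules of finite length, then it is faithful. -/
lemma annihilator_ext_le {N : Type} [AddCommGroup N] [Module A N] (hN : IsFiniteLength A N) :
    Module.annihilator A (ModExt A d N ω) ≤ Module.annihilator A N := by
  have hd {N : Type} [AddCommGroup N] [Module A N] (hN : IsFiniteLength A N) :=
    hN.ext_duality (Z := ω) (d := d) (fun j hj => (Nat.lt_or_gt_of_ne hj).elim (hω j) (hi _ j)) hl
  intro a ha
  let φ : N →ₗ[A] N := a • LinearMap.id
  have hfin (S : Submodule A N) : IsFiniteLength A S := hN.of_injective S.subtype_injective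
  have hn := (isFiniteLength_iff_isNoetherian_isArtinian.1 hN).1
  have hs : Function.Surjective (ModExt.pre d ω (LinearMap.range φ).subtype) :=
    ModExt.pre_surjective (Submodule.subtype_injective _) (LinearMap.exact_subtype_mkQ _)
      (Submodule.mkQ_surjective _) d (hi _ _ (by lia))
  have hinj : Function.Injective (ModExt.pre d ω φ.rangeRestrict) :=
    ModExt.pre_injective (LinearMap.ker φ).subtype_injective
      (fun x => by simp [← LinearMap.mem_ker]) φ.surjective_rangeRestrict d
      fun j hj => (hd (hfin _)).1 j hj.ne
  have h0 : Subsingleton (ModExt A d (LinearMap.range φ) ω) := by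
    refine subsingleton_of_forall_eq 0 fun e => hinj ?_
    obtain ⟨e, rfl⟩ := hs e
    rw [← ModExt.pre_comp, map_zero]
    exact (ModExt.pre_smul_id d a e).trans (Module.mem_annihilator.1 ha e)
  have h1 : Subsingleton (LinearMap.range φ) := by
    rw [← Module.length_eq_zero_iff (R := A), ← (hd (hfin _)).2, Module.length_eq_zero]
  refine Module.mem_annihilator.2 fun x => ?_
  exact congrArg Subtype.val (Subsingleton.elim (⟨φ x, x, rfl⟩ : LinearMap.range φ) 0)

omit hω hi hl in
lemma DepthGE.ext_eq_zero (hi : InjDimLE A d ω) {N : Type} [AddCommGroup N] [Module A N]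
    [Module.Finite A N] (hN : DepthGE A d N) {j : ℕ} (hj : 0 < j) :
    Subsingleton (ModExt A j N ω) :=
  ModExt.subsingleton_of_depthGE hi d hN j (by lia)

lemma bijective_lsmul (hdim : ringKrullDim A = d) (hA : DepthGE A d A) :
    Function.Bijective (LinearMap.lsmul A ω) := by
  have hd {N : Type} [AddCommGroup N] [Module A N] (hN : IsFiniteLength A N) :=
    hN.ext_duality (Z := ω) (d := d) (fun j hj => (Nat.lt_or_gt_of_ne hj).elim (hω j) (hi _ j)) hl
  have key {n : ℕ} (hn : n ≠ 0) : ∃ I : Ideal A, I ≤ maximalIdeal A ^ n ∧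
      (∀ a, LinearMap.lsmul A ω a ∈ (I • ⊤ : Submodule A (ω →ₗ[A] ω)) → a ∈ I) ∧
      ⊤ ≤ LinearMap.range (LinearMap.lsmul A ω) ⊔ I • ⊤ := by
    obtain ⟨rs, hlen, hle, hart, h₁, h₂⟩ := exists_parameter_ideal hdim hA hn hω
    refine ⟨Ideal.ofList rs, hle, ?_⟩
    set I := Ideal.ofList rs
    have hfl (N : Type) [AddCommGroup N] [Module A N] [Module.Finite A N] :
        IsFiniteLength A (N ⧸ (I • ⊤ : Submodule A N)) :=
      isFiniteLength_of_le_annihilator (le_annihilator_quotient_smul_top I N)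
    have hE {N : Type} [AddCommGroup N] [Module A N] [Module.Finite A N] (hN : DepthGE A d N)
        (hr : IsWeaklyRegular N rs) :
        Nonempty (ModExt A d (N ⧸ (I • ⊤ : Submodule A N)) ω ≃ₗ[A]
          (N →ₗ[A] ω) ⧸ (I • ⊤ : Submodule A (N →ₗ[A] ω))) := by
      obtain ⟨E⟩ := (nonempty_ext_quotient_weaklyRegular (Z := ω) rs (c := 0)
        (fun j hj => hN.ext_eq_zero hi hj) hr).2
      rw [zero_add, hlen] at E
      exact ⟨E ≪≫ₗ Submodule.Quotient.equiv _ _ ModExt.ofHom.symm (by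
        rw [Submodule.map_smul'', Submodule.map_top, LinearEquiv.range])⟩
    obtain ⟨E₁⟩ := hE hA h₁
    obtain ⟨E₂⟩ := hE hω h₂
    let E₁' := E₁ ≪≫ₗ Submodule.Quotient.equiv _ (I • ⊤ : Submodule A ω)
      (LinearMap.ringLmapEquivSelf A A ω) (by
        rw [Submodule.map_smul'', Submodule.map_top, LinearEquiv.range])
    have hmem : ∀ a, LinearMap.lsmul A ω a ∈ (I • ⊤ : Submodule A (ω →ₗ[A] ω)) → a ∈ I := by
      intro a ha
      have h1 : a ∈ Module.annihilator A (ω ⧸ (I • ⊤ : Submodule A ω)) := by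
        refine Module.mem_annihilator.2 fun q => ?_
        obtain ⟨b, rfl⟩ := Submodule.mkQ_surjective _ q
        rw [← map_smul, Submodule.mkQ_apply, Submodule.Quotient.mk_eq_zero]
        have : Submodule.map (LinearMap.applyₗ b) (I • ⊤ : Submodule A (ω →ₗ[A] ω)) ≤ I • ⊤ := by
          rw [Submodule.map_smul'']
          exact Submodule.smul_mono le_rfl le_top
        exact this ⟨_, ha, rfl⟩
      rw [← E₁'.annihilator_eq] at h1
      have h2 := Module.mem_annihilator.1 (annihilator_ext_le hω hi hl (hfl A) h1)
        (Submodule.mkQ _ 1)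
      rw [← map_smul, Submodule.mkQ_apply, Submodule.Quotient.mk_eq_zero] at h2
      simpa using h2
    refine ⟨hmem, ?_⟩
    let ψ : (A ⧸ (I • ⊤ : Submodule A A)) →ₗ[A]
        ((ω →ₗ[A] ω) ⧸ (I • ⊤ : Submodule A (ω →ₗ[A] ω))) :=
      Submodule.mapQ _ _ (LinearMap.lsmul A ω) (Submodule.map_le_iff_le_comap.1 (by
        rw [Submodule.map_smul'']
        exact Submodule.smul_mono le_rfl le_top))
    have hψ : Function.Injective ψ := by
      rw [injective_iff_map_eq_zero]
      intro q hq
      obtain ⟨a, rfl⟩ := Submodule.mkQ_surjective _ q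
      rw [Submodule.mkQ_apply, Submodule.mapQ_apply, Submodule.Quotient.mk_eq_zero] at hq
      rw [Submodule.mkQ_apply, Submodule.Quotient.mk_eq_zero]
      simpa using hmem a hq
    have hlen : Module.length A (A ⧸ (I • ⊤ : Submodule A A)) =
        Module.length A ((ω →ₗ[A] ω) ⧸ (I • ⊤ : Submodule A (ω →ₗ[A] ω))) := by
      rw [← E₂.length_eq, (hd (hfl ω)).2, ← E₁'.length_eq, (hd (hfl A)).2]
    have hψs : Function.Surjective ψ := by
      have h3 := Module.length_eq_add_of_exact ψ (LinearMap.range ψ).mkQ hψ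
        (Submodule.mkQ_surjective _) (LinearMap.exact_map_mkQ_range ψ)
      rw [← hlen] at h3
      have h4 := Module.length_ne_top_iff.2 (hfl A)
      have h5 : Module.length A (_ ⧸ LinearMap.range ψ) = 0 :=
        (WithTop.add_left_cancel h4 ((add_zero _).trans h3)).symm
      rwa [Module.length_eq_zero_iff, Submodule.Quotient.subsingleton_iff,
        LinearMap.range_eq_top] at h5
    intro h _
    obtain ⟨q, hq⟩ := hψs (Submodule.mkQ _ h)
    obtain ⟨a, rfl⟩ := Submodule.mkQ_surjective _ q
    rw [Submodule.mkQ_apply, Submodule.mapQ_apply, Submodule.mkQ_apply,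
      Submodule.Quotient.eq] at hq
    rw [← sub_sub_cancel (LinearMap.lsmul A ω a) h]
    exact sub_mem (Submodule.mem_sup_left ⟨a, rfl⟩) (Submodule.mem_sup_right hq)
  constructor
  · rw [injective_iff_map_eq_zero]
    intro a ha
    rw [← Ideal.mem_bot, ← Ideal.iInf_pow_eq_bot_of_isLocalRing (maximalIdeal A)
      (maximalIdeal.isMaximal A).ne_top, Ideal.mem_iInf]
    intro n
    obtain ⟨I, hI, h, -⟩ := key (Nat.succ_ne_zero n)
    exact Ideal.pow_le_pow_right (Nat.le_succ n) (hI (h a (ha ▸ zero_mem _)))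
  · obtain ⟨I, hI, -, h⟩ := key one_ne_zero
    rw [← LinearMap.range_eq_top, ← top_le_iff]
    exact Submodule.le_of_le_smul_of_le_jacobson_bot Module.Finite.fg_top
      ((hI.trans (pow_one _).le).trans (maximalIdeal_le_jacobson _)) h

end Endomorphism

end CanonicalModule

noncomputable section Duality

open IsLocalRing

section Exact

variable {A : Type} [CommRing A] {M M' M'' Z : Type} [AddCommGroup M] [Module A M] [AddCommGroup M'] [Module A M']
  [AddCommGroup M''] [Module A M''] [AddCommGroup Z] [Module A Z] {f : M →ₗ[A] M'}
  {g : M' →ₗ[A] M''}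

lemma dmap_surjective (hf : Function.Injective f) (hfg : Function.Exact f g)
    (hg : Function.Surjective g) (h : Subsingleton (ModExt A 1 M'' Z)) :
    Function.Surjective (dmap A Z f) := fun φ => by
  obtain ⟨e, he⟩ := ModExt.pre_surjective hf hfg hg 0 h (ModExt.ofHom φ)
  obtain ⟨ψ, rfl⟩ := ModExt.ofHom.surjective e
  rw [ModExt.pre_ofHom] at he
  exact ⟨ψ, ModExt.ofHom.injective he⟩

lemma dmap_exact (hfg : Function.Exact f g) (hg : Function.Surjective g) :
    Function.Exact (dmap A Z g) (dmap A Z f) :=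
  LinearMap.exact_lcomp_of_exact_of_surjective _ hfg hg

lemma dmap_injective (hg : Function.Surjective g) : Function.Injective (dmap A Z g) :=
  LinearMap.lcomp_injective_of_surjective g hg

lemma deltaMap_naturality (f : M →ₗ[A] M') (x : M) :
    deltaMap A Z M' (f x) = dmap A Z (dmap A Z f) (deltaMap A Z M x) := rfl

end Exact

variable {A : Type} [CommRing A] [IsLocalRing A] {d : ℕ}

/-- The properties of a canonical module of a `d`-dimensional Cohen-Macaulay local ring
on which the duality of maximal Cohen-Macaulay modules rests. -/
structure IsDualizing (A : Type) [CommRing A] [IsLocalRing A] (d : ℕ) (ω : Type) [AddCommGroup ω]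
    [Module A ω] : Prop where
  depth_ring : DepthGE A d A
  finite : Module.Finite A ω
  depth : DepthGE A d ω
  injDim : InjDimLE A d ω
  bijective : Function.Bijective (LinearMap.lsmul A ω)

lemma IsCanonicalModule.isDualizing [IsNoetherianRing A] (hdim : ringKrullDim A = d)
    (hA : (d : ℕ∞) ≤ rdepth A A) {ω : Type} [AddCommGroup ω] [Module A ω]
    (hω : IsCanonicalModule A d ω) : IsDualizing A d ω := by
  obtain ⟨hM, ⟨n, hn⟩, ⟨e⟩⟩ := hω
  obtain ⟨hf, hd⟩ := (isMCM_iff d ω).1 hM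
  have hA := (natCast_le_rdepth_iff d A).1 hA
  have hi : InjDimLE A d ω := InjDimLE.dim hdim hA (n := n) fun N _ _ _ j hj =>
    haveI := hn N j hj
    (ext1Equiv j N ω).symm.toEquiv.subsingleton
  refine ⟨hA, hf, hd, hi, bijective_lsmul hd hi ?_ hdim hA⟩
  rw [((ext1Equiv d (ResidueField A) ω).symm ≪≫ₗ e).length_eq]
  have : IsSimpleModule A (A ⧸ maximalIdeal A) := isSimpleModule_iff_quot_maximal.2
    ⟨_, maximalIdeal.isMaximal A, ⟨LinearEquiv.refl _ _⟩⟩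
  exact Module.length_eq_one A (A ⧸ maximalIdeal A)

namespace DepthGE

variable {M N P : Type} [AddCommGroup M] [Module A M]
  [AddCommGroup N] [Module A N] [AddCommGroup P] [Module A P]

lemma of_exact {t : ℕ} {f : M →ₗ[A] N} {g : N →ₗ[A] P} (hf : Function.Injective f)
    (hfg : Function.Exact f g) (hg : Function.Surjective g)
    (hN : DepthGE A t N) (hP : DepthGE A t P) : DepthGE A t M := by
  rcases t with _ | t
  · exact fun m hm => absurd hm (by lia)
  · exact .left hf hfg hg hN (hP.mono (by lia))

end DepthGE

lemma exists_syzygy {t : ℕ} (hA : DepthGE A t A) (Z : Type) [AddCommGroup Z] [Module A Z]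
    [Module.Finite A Z] (hZ : DepthGE A t Z) : ∃ (n : ℕ) (g : (Fin n → A) →ₗ[A] Z),
      Function.Surjective g ∧ DepthGE A t (LinearMap.ker g) := by
  obtain ⟨n, g, hg⟩ := Module.Finite.exists_fin' A Z
  exact ⟨n, g, hg, .of_exact (LinearMap.ker g).subtype_injective
    (LinearMap.exact_subtype_ker_map g) hg hA.pi hZ⟩

namespace IsDualizing

variable [IsNoetherianRing A] {ω : Type} [AddCommGroup ω] [Module A ω] (hω : IsDualizing A d ω)
  {Z : Type} [AddCommGroup Z] [Module A Z] [Module.Finite A Z]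
include hω

lemma ext_eq_zero (hZ : DepthGE A d Z) {j : ℕ} (hj : 0 < j) : Subsingleton (ModExt A j Z ω) :=
  haveI := hω.finite
  hZ.ext_eq_zero hω.injDim hj

omit [IsNoetherianRing A] in
lemma depth_free_dual (n : ℕ) : DepthGE A d ((Fin n → A) →ₗ[A] ω) :=
  hω.depth.pi.of_equiv ((Pi.basisFun A (Fin n)).constr A)

lemma depth_dual (hZ : DepthGE A d Z) : DepthGE A d (Z →ₗ[A] ω) := by
  suffices h : ∀ t ≤ d, ∀ (Z : Type) [AddCommGroup Z] [Module A Z] [Module.Finite A Z],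
      DepthGE A d Z → DepthGE A t (Z →ₗ[A] ω) from h d le_rfl Z hZ
  intro t
  induction t with
  | zero => exact fun _ _ _ _ _ _ m hm => absurd hm (by lia)
  | succ t ih =>
    intro ht Z _ _ _ hZ
    obtain ⟨n, g, hg, hk⟩ := exists_syzygy hω.depth_ring Z hZ
    exact .left (dmap_injective hg) (dmap_exact (LinearMap.exact_subtype_ker_map g) hg)
      (dmap_surjective (LinearMap.ker g).subtype_injective (LinearMap.exact_subtype_ker_map g) hg
        (hω.ext_eq_zero hZ one_pos)) ((hω.depth_free_dual n).mono ht) (ih (by lia) _ hk)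

omit [IsNoetherianRing A] in
lemma deltaMap_free_bijective (n : ℕ) : Function.Bijective (deltaMap A ω (Fin n → A)) := by
  constructor
  · rw [injective_iff_map_eq_zero]
    intro x hx
    funext i
    refine hω.bijective.1 (LinearMap.ext fun w => ?_)
    simpa [deltaMap] using
      LinearMap.congr_fun hx (LinearMap.toSpanSingleton A ω w ∘ₗ LinearMap.proj i)
  · intro Φ
    have h (i : Fin n) : ∃ a : A, ∀ w : ω,
        Φ (LinearMap.toSpanSingleton A ω w ∘ₗ LinearMap.proj i) = a • w := by
      obtain ⟨a, ha⟩ := hω.bijective.2 (Φ ∘ₗ LinearMap.lcomp A ω (LinearMap.proj i) ∘ₗ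
        (LinearMap.ringLmapEquivSelf A A ω).symm)
      exact ⟨a, fun w => (LinearMap.congr_fun ha w).symm⟩
    choose a ha using h
    refine ⟨a, LinearMap.ext fun f => ?_⟩
    have hf : f = ∑ i, LinearMap.toSpanSingleton A ω (f (Pi.single i 1)) ∘ₗ LinearMap.proj i := by
      ext i
      simp [Pi.single_apply]
    conv_rhs => rw [hf, map_sum]
    simp only [ha, ← map_smul, ← map_sum]
    refine congrArg f (funext fun i => ?_)
    simp [Finset.sum_apply, Pi.single_apply]

lemma deltaMap_surjective (hZ : DepthGE A d Z) : Function.Surjective (deltaMap A ω Z) := by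
  have := hω.finite
  obtain ⟨n, g, hg, hk⟩ := exists_syzygy hω.depth_ring Z hZ
  have hex := LinearMap.exact_subtype_ker_map g
  have hs : Function.Surjective (dmap A ω (dmap A ω g)) :=
    dmap_surjective (dmap_injective hg) (dmap_exact hex hg)
      (dmap_surjective (LinearMap.ker g).subtype_injective hex hg (hω.ext_eq_zero hZ one_pos))
      (hω.ext_eq_zero (hω.depth_dual hk) one_pos)
  intro Φ
  obtain ⟨Ψ, rfl⟩ := hs Φ
  obtain ⟨y, rfl⟩ := (hω.deltaMap_free_bijective n).2 Ψ
  exact ⟨g y, deltaMap_naturality g y⟩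

/-- Maximal Cohen-Macaulay modules are reflexive with respect to a dualizing module. -/
lemma deltaMap_bijective (hZ : DepthGE A d Z) : Function.Bijective (deltaMap A ω Z) := by
  refine ⟨?_, hω.deltaMap_surjective hZ⟩
  obtain ⟨n, g, hg, hk⟩ := exists_syzygy hω.depth_ring Z hZ
  have hex := LinearMap.exact_subtype_ker_map g
  rw [injective_iff_map_eq_zero]
  intro x hx
  obtain ⟨y, rfl⟩ := hg x
  rw [deltaMap_naturality] at hx
  obtain ⟨Φ, hΦ⟩ := (dmap_exact (Z := ω) (dmap_exact hex hg)
    (dmap_surjective (LinearMap.ker g).subtype_injective hex hg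
      (hω.ext_eq_zero hZ one_pos)) _).1 hx
  obtain ⟨z, rfl⟩ := hω.deltaMap_surjective hk Φ
  rw [← deltaMap_naturality] at hΦ
  rw [← (hω.deltaMap_free_bijective n).1 hΦ]
  exact z.2

end IsDualizing

end Duality

noncomputable section LocalVanishing

open IsLocalRing

variable {A : Type} [CommRing A] {ω : Type} [AddCommGroup ω] [Module A ω]

/-- The localization of the module `E` at the prime `p` vanishes. -/
def LocZero {A : Type} [CommRing A] (p : PrimeSpectrum A) (E : Type) [AddCommGroup E]
    [Module A E] : Prop :=
  ∀ e : E, ∃ s ∉ p.1, s • e = 0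

namespace LocZero

variable {p : PrimeSpectrum A} {E E' E'' : Type} [AddCommGroup E] [Module A E] [AddCommGroup E']
  [Module A E'] [AddCommGroup E''] [Module A E'']

lemma of_subsingleton [Subsingleton E] : LocZero p E :=
  fun _ => ⟨1, p.1.primeCompl.one_mem, Subsingleton.elim _ _⟩

lemma of_injective (h : LocZero p E') {f : E →ₗ[A] E'} (hf : Function.Injective f) :
    LocZero p E := fun e => by
  obtain ⟨s, hs, h⟩ := h (f e)
  exact ⟨s, hs, hf (by simpa using h)⟩

lemma of_exact {f : E →ₗ[A] E'} {g : E' →ₗ[A] E''} (hfg : Function.Exact f g) (h : LocZero p E)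
    (h'' : LocZero p E'') : LocZero p E' := fun e => by
  obtain ⟨s, hs, h₁⟩ := h'' (g e)
  obtain ⟨e', he⟩ := (hfg (s • e)).1 (by rw [map_smul, h₁])
  obtain ⟨t, ht, h₂⟩ := h e'
  exact ⟨t * s, p.1.primeCompl.mul_mem ht hs, by rw [mul_smul, ← he, ← map_smul, h₂, map_zero]⟩

lemma of_smul_surjective [Module.Finite A E] {x : A} (hx : x ∈ p.1)
    (h : ∀ e : E, ∃ s ∉ p.1, ∃ e', s • e = x • e') : LocZero p E := by
  have := Submodule.eq_bot_of_le_smul_of_le_jacobson_bot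
    (maximalIdeal (Localization.AtPrime p.1))
    (⊤ : Submodule (Localization.AtPrime p.1) (LocalizedModule p.1.primeCompl E))
    Module.Finite.fg_top (fun e _ => by
      induction e with | h e t =>
      obtain ⟨s, hs, e', he⟩ := h e
      have h₁ : LocalizedModule.mk e t =
          algebraMap A (Localization.AtPrime p.1) x • LocalizedModule.mk e' (⟨s, hs⟩ * t) := by
        rw [algebraMap_smul, LocalizedModule.smul'_mk, ← he]
        exact (LocalizedModule.mk_cancel_common_left (⟨s, hs⟩ : p.1.primeCompl) t e).symm
      rw [h₁]
      exact Submodule.smul_mem_smul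
        ((IsLocalization.AtPrime.to_map_mem_maximal_iff _ p.1 x).2 hx) trivial)
    (maximalIdeal_le_jacobson _)
  intro e
  have he : LocalizedModule.mk e (1 : p.1.primeCompl) = 0 :=
    (Submodule.mem_bot (Localization.AtPrime p.1)).1 (this ▸ Submodule.mem_top)
  obtain ⟨s, hs⟩ := LocalizedModule.mk_eq.1 (he.trans (LocalizedModule.zero_mk 1).symm)
  exact ⟨s, s.2, by simpa [Submonoid.smul_def] using hs⟩

end LocZero

/-- All the modules `Ext^j(-, ω)` of finite modules vanish at `q`. -/
def LocExtZero (A : Type) [CommRing A] (ω : Type) [AddCommGroup ω] [Module A ω]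
    (j : ℕ) (q : PrimeSpectrum A) : Prop :=
  ∀ (N : Type) [AddCommGroup N] [Module A N] [Module.Finite A N], LocZero q (ModExt A j N ω)

lemma LocExtZero.of_lt [IsNoetherianRing A] [Module.Finite A ω] {j : ℕ} {p q : PrimeSpectrum A}
    (hpq : p < q) (h : LocExtZero A ω (j + 1) q) : LocExtZero A ω j p := by
  intro N _ _ _
  refine IsNoetherianRing.induction_on_isQuotientEquivQuotientPrime A (M := N) inferInstance
    (motive := fun N _ _ _ => LocZero p (ModExt A j N ω)) ?_ ?_ ?_
  · intro N _ _ _ _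
    have : Subsingleton (ModExt A j N ω) := ModExt.subsingleton_left j
    exact .of_subsingleton
  · intro N _ _ _ p' e
    refine LocZero.of_injective ?_ (ModExt.preEquiv j ω e).symm.injective
    by_cases hp : p' ≤ p
    · obtain ⟨x, hxq, hxp⟩ := SetLike.exists_of_lt (show p.1 < q.1 from hpq)
      obtain ⟨δ, hδ, -⟩ := exists_quotSMulTop_delta (isSMulRegular_quotient_prime p'
        (fun hx => hxp (hp hx))) j ω
      have : LocZero q (ModExt A j (A ⧸ p'.1) ω) := .of_smul_surjective hxq fun e => by
        obtain ⟨s, hs, hse⟩ := h _ (δ e)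
        rw [← map_smul, hδ] at hse
        obtain ⟨e', he⟩ := hse
        exact ⟨s, hs, e', he.symm⟩
      exact fun e => (this e).imp fun s hs => ⟨fun hsp => hs.1 (hpq.le hsp), hs.2⟩
    · obtain ⟨s, hs, hsp⟩ := Set.not_subset.1 (show ¬ (p'.1 : Set A) ⊆ p.1 from hp)
      exact fun e => ⟨s, hsp, ModExt.smul_eq_zero_left
        ((Ideal.annihilator_quotient (I := p'.1)).ge hs) e⟩
  · intro N₁ _ _ _ N₂ _ _ _ N₃ _ _ _ f g hf hg hfg h₁ h₃
    exact .of_exact (ModExt.pre_exact hf hfg hg j ω) h₃ h₁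

lemma LocExtZero.head [IsNoetherianRing A] [Module.Finite A ω] {j : ℕ} 
    (s : LTSeries (PrimeSpectrum A)) (h : LocExtZero A ω (j + s.length) s.last) :
    LocExtZero A ω j s.head := by
  have key : ∀ k, ∀ hk : k ≤ s.length, LocExtZero A ω (j + s.length - k) 
      (s ⟨s.length - k, by lia⟩) := by
    intro k
    induction k with
    | zero => exact fun _ => h
    | succ k ih =>
      intro hk
      refine LocExtZero.of_lt (q := s ⟨s.length - k, by lia⟩) (s.strictMono ?_) ?_
      · exact Fin.mk_lt_mk.2 (by lia)
      · convert ih (by lia) using 1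
        lia
  have := key s.length le_rfl
  simp only [Nat.sub_self, Nat.add_sub_cancel] at this
  exact this

lemma codGT_of_locExtZero [IsNoetherianRing A] [IsLocalRing A] [Module.Finite A ω] {d : ℕ}
    (hω : InjDimLE A d ω) (i : ℕ) {K : Type} [AddCommGroup K] [Module A K] [Module.Finite A K]
    (h : ∀ p, LocExtZero A ω (i + 1) p → LocZero p K) : codGT A d K i := by
  have hV (j : ℕ) (hj : d < j) (p : PrimeSpectrum A) : LocExtZero A ω j p := fun N _ _ _ => by
    have := hω N j hj
    exact .of_subsingleton
  rw [codGT]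
  by_contra! hle
  rcases le_or_gt d i with hdi | hdi
  · have h0 : Subsingleton K := subsingleton_of_forall_eq 0 fun y => by
      obtain ⟨s, hs, hy⟩ := h ⟨maximalIdeal A, inferInstance⟩ (hV _ (by lia) _) y
      have hu : IsUnit s := by simpa using hs
      exact hu.smul_eq_zero.1 hy
    rw [mdim, (Module.annihilator_eq_top_iff (R := A)).2 h0] at hle
    have : Subsingleton (A ⧸ (⊤ : Ideal A)) := Ideal.Quotient.subsingleton_iff.2 rfl
    rw [ringKrullDim_eq_bot_of_subsingleton] at hle
    simp at hle
  · have hle' : ((d - i : ℕ) : WithBot ℕ∞) ≤ mdim A K := by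
      revert hle
      generalize mdim A K = x
      intro hle
      induction x using WithBot.recBotCoe with
      | bot => simp at hle
      | coe x =>
        induction x using ENat.recTopCoe with
        | top => exact WithBot.coe_le_coe.2 le_top
        | coe x =>
          have : d ≤ x + i := by exact_mod_cast hle
          exact WithBot.coe_le_coe.2 (Nat.cast_le.2 (by lia))
    obtain ⟨s, hs⟩ := Order.le_krullDim_iff.1 hle'
    let s' : LTSeries (PrimeSpectrum A) := s.map (PrimeSpectrum.comap (Ideal.Quotient.mk _))
      (Monotone.strictMono_of_injective (fun _ _ h => Ideal.comap_mono h)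
        (PrimeSpectrum.comap_injective_of_surjective _ Ideal.Quotient.mk_surjective))
    have h0 : LocExtZero A ω (i + 1) s'.head := .head _ (hV _ (by simp [s']; lia) _)
    have h1 : s'.head ∈ Module.support A K := by
      rw [Module.support_eq_zeroLocus]
      intro a ha
      have : Ideal.Quotient.mk (Module.annihilator A K) a ∈ s.head.1 := by
        rw [Ideal.Quotient.eq_zero_iff_mem.2 ha]
        exact zero_mem _
      exact this
    refine absurd h1 (Module.notMem_support_iff'.2 fun y => ?_)
    exact h _ h0 y

section Complex

variable {G G' G'' : Type} [AddCommGroup G] [Module A G] [AddCommGroup G'] [Module A G']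
  [AddCommGroup G''] [Module A G''] {a : G →ₗ[A] G'} {b : G' →ₗ[A] G''}

/-- The cokernel of the dual of a map. -/
abbrev dualCoker (ω : Type) [AddCommGroup ω] [Module A ω] (a : G →ₗ[A] G') : Type :=
  (G →ₗ[A] ω) ⧸ LinearMap.range (dmap A ω a)

lemma LocZero.ext_dualCoker {p : PrimeSpectrum A} {m : ℕ}
    (hG : Subsingleton (ModExt A m (G →ₗ[A] ω) ω))
    (hab : Function.Exact (dmap A ω b) (dmap A ω a))
    (h : LocZero p (ModExt A (m + 1) (dualCoker ω a) ω)) :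
    LocZero p (ModExt A m (dualCoker ω b) ω) := by
  obtain ⟨δ, h₁, -⟩ := ModExt.exists_pre_delta (LinearMap.range (dmap A ω a)).subtype_injective
    (LinearMap.exact_subtype_mkQ _) (Submodule.mkQ_surjective _) m ω
  have hδ : Function.Injective δ := by
    rw [injective_iff_map_eq_zero]
    intro e he
    obtain ⟨e', rfl⟩ := (h₁ e).1 he
    rw [Subsingleton.elim e' 0, map_zero]
  have e : dualCoker ω b ≃ₗ[A] LinearMap.range (dmap A ω a) :=
    Submodule.quotEquivOfEq _ _ (LinearMap.exact_iff.1 hab).symm ≪≫ₗ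
      (dmap A ω a).quotKerEquivRange
  exact (h.of_injective hδ).of_injective (ModExt.preEquiv m ω e).symm.injective

lemma exists_smul_mem_range {p : PrimeSpectrum A}
    (hab : Function.Exact (dmap A ω b) (dmap A ω a))
    (hG : Function.Surjective (deltaMap A ω G)) (hG' : Function.Injective (deltaMap A ω G'))
    (h : LocZero p (ModExt A 1 (dualCoker ω a) ω)) {y : G'} (hy : b y = 0) :
    ∃ s ∉ p.1, s • y ∈ LinearMap.range a := by
  obtain ⟨δ, h₁, -⟩ := ModExt.exists_pre_delta (LinearMap.range (dmap A ω a)).subtype_injective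
    (LinearMap.exact_subtype_mkQ _) (Submodule.mkQ_surjective _) 0 ω
  have hker : LinearMap.ker (dmap A ω a) ≤ LinearMap.ker (deltaMap A ω G' y) := by
    intro φ hφ
    obtain ⟨ψ, rfl⟩ := (hab φ).1 hφ
    change ψ (b y) = 0
    rw [hy, map_zero]
  let φ : LinearMap.range (dmap A ω a) →ₗ[A] ω :=
    Submodule.liftQ _ (deltaMap A ω G' y) hker ∘ₗ (dmap A ω a).quotKerEquivRange.symm
  have hφ (ψ : G' →ₗ[A] ω) : φ ⟨dmap A ω a ψ, ψ, rfl⟩ = ψ y := by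
    have := (dmap A ω a).quotKerEquivRange_symm_apply_image ψ ⟨ψ, rfl⟩
    simp only [φ, LinearMap.comp_apply, LinearEquiv.coe_coe, this]
    rfl
  obtain ⟨s, hs, hse⟩ := h (δ (ModExt.ofHom φ))
  refine ⟨s, hs, ?_⟩
  rw [← map_smul] at hse
  obtain ⟨e, he⟩ := (h₁ _).1 hse
  obtain ⟨Φ, rfl⟩ := ModExt.ofHom.surjective e
  rw [ModExt.pre_ofHom, ← map_smul] at he
  have he := ModExt.ofHom.injective he
  obtain ⟨x, rfl⟩ := hG Φ
  refine ⟨x, hG' (LinearMap.ext fun ψ => ?_)⟩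
  have := LinearMap.congr_fun he ⟨dmap A ω a ψ, ψ, rfl⟩
  rw [LinearMap.smul_apply, hφ] at this
  rw [map_smul, LinearMap.smul_apply]
  exact this

end Complex

end LocalVanishing

noncomputable section Kernels

open IsLocalRing

variable {A : Type} [CommRing A] {ω : Type} [AddCommGroup ω] [Module A ω]

lemma dmap_exact_of_extends {G G' C X : Type} [AddCommGroup G] [Module A G] [AddCommGroup G']
    [Module A G'] [AddCommGroup C] [Module A C] [AddCommGroup X] [Module A X] {a : G →ₗ[A] G'}
    {q : G' →ₗ[A] C} {μ : C →ₗ[A] X} (haq : Function.Exact a q) (hq : Function.Surjective q)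
    (hμ : Function.Surjective (dmap A ω μ)) :
    Function.Exact (dmap A ω (μ ∘ₗ q)) (dmap A ω a) := fun φ => by
  rw [dmap_exact haq hq φ]
  refine ⟨?_, ?_⟩
  · rintro ⟨ψ, rfl⟩
    obtain ⟨χ, rfl⟩ := hμ ψ
    exact ⟨χ, rfl⟩
  · rintro ⟨χ, rfl⟩
    exact ⟨dmap A ω μ χ, rfl⟩

variable [IsLocalRing A] {M : Type} [AddCommGroup M] [Module A M] {X : ℕ → ModuleCat.{0} A}
  {d0 : M →ₗ[A] ↥(X 0)} {dn : ∀ i, ↥(X i) →ₗ[A] ↥(X (i + 1))}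
  {hc0 : LinearMap.range d0 ≤ LinearMap.ker (dn 0)}
  {hc : ∀ i, LinearMap.range (dn i) ≤ LinearMap.ker (dn (i + 1))}

/-- The projection of `X^i` onto `coker d^i`. -/
def toCokerAt (A : Type) [CommRing A] (M : Type) [AddCommGroup M] [Module A M]
    (X : ℕ → ModuleCat.{0} A) (d0 : M →ₗ[A] ↥(X 0)) (dn : ∀ i, ↥(X i) →ₗ[A] ↥(X (i + 1))) :
    ∀ i, ↥(X i) →ₗ[A] cokerAt A M X d0 dn (i + 1)
  | 0 => Submodule.mkQ (LinearMap.range d0)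
  | i + 1 => Submodule.mkQ (LinearMap.range (dn i))

omit [IsLocalRing A] in
lemma toCokerAt_surjective : ∀ i, Function.Surjective (toCokerAt A M X d0 dn i)
  | 0 => Submodule.mkQ_surjective _
  | _ + 1 => Submodule.mkQ_surjective _

omit [IsLocalRing A] in
lemma muAt_comp_toCokerAt : ∀ i, muAt A M X d0 dn hc0 hc (i + 1) ∘ₗ toCokerAt A M X d0 dn i = dn i
  | 0 => Submodule.liftQ_mkQ _ _ _
  | _ + 1 => Submodule.liftQ_mkQ _ _ _

omit [IsLocalRing A] in
lemma exact_muAt_toCokerAt (i : ℕ) :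
    Function.Exact (muAt A M X d0 dn hc0 hc i) (toCokerAt A M X d0 dn i) := by
  rw [LinearMap.exact_iff]
  match i with
  | 0 => exact Submodule.ker_mkQ _
  | 1 => exact (Submodule.ker_mkQ _).trans (Submodule.range_liftQ _ _ _).symm
  | i + 2 => exact (Submodule.ker_mkQ _).trans (Submodule.range_liftQ _ _ _).symm

variable [IsNoetherianRing A] {d : ℕ}

omit [IsLocalRing A] [IsNoetherianRing A] in
lemma finite_cokerAt [Module.Finite A M] (hX : ∀ i, Module.Finite A (X i)) (i : ℕ) :
    Module.Finite A (cokerAt A M X d0 dn i) := by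
  rcases i with _ | i
  · assumption
  · exact .of_surjective _ (toCokerAt_surjective i)

lemma IsDualizing.codGT_ker_muAt [Module.Finite A M] (hω : IsDualizing A d ω)
    (hX : ∀ i, Module.Finite A (X i)) (hXd : ∀ i, DepthGE A d (X i))
    (hμ : ∀ i, Function.Surjective (dmap A ω (muAt A M X d0 dn hc0 hc i))) (i : ℕ) :
    codGT A d (LinearMap.ker (muAt A M X d0 dn hc0 hc i)) i := by
  have := hω.finite
  have key : ∃ (G G' : ModuleCat.{0} A) (a : G →ₗ[A] G') (q : G' →ₗ[A] cokerAt A M X d0 dn i),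
      (Module.Finite A G ∧ DepthGE A d G) ∧ (Module.Finite A G' ∧ DepthGE A d G') ∧
      Function.Exact a q ∧ Function.Surjective q ∧ ∀ p m, LocExtZero A ω (m + i + 1) p →
        LocZero p (ModExt A (m + 1) (dualCoker ω a) ω) := by
    induction i with
    | zero =>
      obtain ⟨n, q, hq⟩ := Module.Finite.exists_fin' A M
      obtain ⟨m, a, ha⟩ := Module.Finite.exists_fin' A (LinearMap.ker q)
      have hex : Function.Exact ((LinearMap.ker q).subtype ∘ₗ a) q := by
        rw [LinearMap.exact_iff, LinearMap.range_comp, LinearMap.range_eq_top.2 ha,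
          Submodule.map_top, Submodule.range_subtype]
      refine ⟨.of A (Fin m → A), .of A (Fin n → A), (LinearMap.ker q).subtype ∘ₗ a, q,
        ⟨inferInstanceAs (Module.Finite A (Fin m → A)), hω.depth_ring.pi⟩,
        ⟨inferInstanceAs (Module.Finite A (Fin n → A)), hω.depth_ring.pi⟩, hex, hq, ?_⟩
      intro p k h
      have : Module.Finite A (dualCoker ω ((LinearMap.ker q).subtype ∘ₗ a)) := inferInstance
      exact h _
    | succ i ih =>
      obtain ⟨G, G', a, q, ⟨hG, hGd⟩, ⟨hG', hGd'⟩, haq, hq, h⟩ := ih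
      refine ⟨G', X i, muAt A M X d0 dn hc0 hc i ∘ₗ q, toCokerAt A M X d0 dn i, ⟨hG', hGd'⟩,
        ⟨hX i, hXd i⟩, ?_, toCokerAt_surjective i, fun p m hp => ?_⟩
      · rw [LinearMap.exact_iff, LinearMap.range_comp, LinearMap.range_eq_top.2 hq,
          Submodule.map_top, LinearMap.exact_iff.1 (exact_muAt_toCokerAt i)]
      · refine LocZero.ext_dualCoker (hω.ext_eq_zero (hω.depth_dual hGd) (by lia))
          (dmap_exact_of_extends haq hq (hμ i)) (h p (m + 1) ?_)
        rwa [show m + 1 + i + 1 = m + (i + 1) + 1 by lia]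
  obtain ⟨G, G', a, q, ⟨hG, hGd⟩, ⟨hG', hGd'⟩, haq, hq, h⟩ := key
  have := finite_cokerAt (A := A) (M := M) (d0 := d0) (dn := dn) hX i
  refine codGT_of_locExtZero hω.injDim i fun p hp x => ?_
  obtain ⟨y, hy⟩ := hq x
  obtain ⟨s, hs, z, hz⟩ := exists_smul_mem_range (dmap_exact_of_extends haq hq (hμ i))
    (hω.deltaMap_surjective hGd) (hω.deltaMap_bijective hGd').1 (h p 0 (by simpa using hp))
    (y := y) (by simp [hy])
  refine ⟨s, hs, Subtype.ext ?_⟩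
  rw [Submodule.coe_smul, ← hy, ← map_smul, ← hz]
  exact haq.apply_apply_eq_zero z

end Kernels

noncomputable section LocalDepth

open IsLocalRing

/-- The depth of the localization of the module `N` at the prime `p` is at least `t`. -/
def LocDepthGE {A : Type} [CommRing A] (p : PrimeSpectrum A) (t : ℕ) (N : Type)
    [AddCommGroup N] [Module A N] : Prop :=
  DepthGE (Localization.AtPrime p.1) t (LocalizedModule p.1.primeCompl N)

lemma DepthGE.of_smul_exact {B : Type} [CommRing B] [IsLocalRing B] {N P : Type} [AddCommGroup N]
    [Module B N] [AddCommGroup P] [Module B P] {x : B} (hx : x ∈ maximalIdeal B) {g : N →ₗ[B] P}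
    (hi : Function.Injective (x • (LinearMap.id : N →ₗ[B] N)))
    (hfg : Function.Exact (x • (LinearMap.id : N →ₗ[B] N)) g) (hg : Function.Surjective g) {t : ℕ}
    (hP : DepthGE B t P) : DepthGE B (t + 1) N := by
  have hx0 (m : ℕ) (e : ModExt B m (ResidueField B) N) :
      ModExt.post m (ResidueField B) (x • (LinearMap.id : N →ₗ[B] N)) e = 0 := by
    rw [ModExt.post_smul_id]
    exact ModExt.smul_eq_zero_left
      ((Ideal.annihilator_quotient (I := maximalIdeal B)).symm.le hx) e
  rintro (_ | m) hm
  · exact subsingleton_of_forall_eq 0 fun e =>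
      ModExt.post_zero_injective hi (by rw [hx0, map_zero])
  · have := hP m (by lia)
    obtain ⟨δ, -, hδ⟩ := ModExt.exists_post_delta hi hfg hg m (ResidueField B)
    refine subsingleton_of_forall_eq 0 fun e => ?_
    obtain ⟨e', rfl⟩ := (hδ e).1 (hx0 _ e)
    rw [Subsingleton.elim e' 0, map_zero]

namespace LocDepthGE

variable {A : Type} [CommRing A] {p : PrimeSpectrum A} {t : ℕ} {M N P : Type}
  [AddCommGroup M] [Module A M] [AddCommGroup N] [Module A N] [AddCommGroup P] [Module A P]

lemma of_equiv (e : M ≃ₗ[A] N) (h : LocDepthGE p t M) : LocDepthGE p t N :=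
  DepthGE.of_equiv (LinearEquiv.ofBijective (LocalizedModule.map p.1.primeCompl e.toLinearMap)
    ⟨LocalizedModule.map_injective _ _ e.injective,
      LocalizedModule.map_surjective _ _ e.surjective⟩) h

lemma left {f : M →ₗ[A] N} {g : N →ₗ[A] P} (hf : Function.Injective f)
    (hfg : Function.Exact f g) (hg : Function.Surjective g)
    (hN : LocDepthGE p (t + 1) N) (hP : LocDepthGE p t P) : LocDepthGE p (t + 1) M :=
  DepthGE.left (LocalizedModule.map_injective _ f hf)
    (g := LocalizedModule.map p.1.primeCompl g) (LocalizedModule.map_exact _ f g hfg)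
    (LocalizedModule.map_surjective _ g hg) hN hP

lemma of_exact_of_le_two {f : M →ₗ[A] N} {g : N →ₗ[A] P} (hf : Function.Injective f)
    (hfg : Function.Exact f g) (ht : t ≤ 2)
    (hN : LocDepthGE p t N) (hP : LocDepthGE p t P) : LocDepthGE p t M := by
  have h := LinearMap.exact_iff.1 (show Function.Exact (LocalizedModule.map p.1.primeCompl f)
    (LocalizedModule.map p.1.primeCompl g) from LocalizedModule.map_exact _ f g hfg)
  exact ((DepthGE.ker _ hN hP ht le_rfl).of_equiv (LinearEquiv.ofEq _ _ h)).of_equiv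
    (LinearEquiv.ofInjective _ (LocalizedModule.map_injective _ f hf)).symm

/-- Depth at `p` is detected by the modules `Ext^m(A/p, N)`. -/
lemma of_ext [IsNoetherianRing A] : ∀ {t : ℕ} {N : Type} [AddCommGroup N] [Module A N]
    [Module.Finite A N], (∀ m < t, Subsingleton (ModExt A m (A ⧸ p.1) N)) → LocDepthGE p t N
  | 0, _, _, _, _, _ => fun m hm => by lia
  | t + 1, N, _, _, _, h => by
    obtain ⟨x, hx, hreg⟩ := IsSMulRegular.subsingleton_linearMap_iff.1
      (ModExt.subsingleton_zero_iff.1 (h 0 (by lia)))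
    have hxp : x ∈ p.1 := (Ideal.annihilator_quotient (I := p.1)).le hx
    have hi : Function.Injective (x • (LinearMap.id : N →ₗ[A] N)) := fun _ _ e => hreg e
    have hq : LocDepthGE p t (QuotSMulTop x N) := of_ext fun m hm =>
      ModExt.subsingleton_post_right hi (exact_smul_mkQ x N) (Submodule.mkQ_surjective _)
        (h m (by lia)) (h (m + 1) (by lia))
    have hmap : LocalizedModule.map p.1.primeCompl (x • (LinearMap.id : N →ₗ[A] N)) =
        algebraMap A (Localization.AtPrime p.1) x • LinearMap.id := by
      ext y
      simp [algebraMap_smul]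
    refine DepthGE.of_smul_exact ((IsLocalization.AtPrime.to_map_mem_maximal_iff _ p.1 x).2 hxp)
      (g := LocalizedModule.map p.1.primeCompl (Submodule.mkQ _)) ?_ ?_
      (LocalizedModule.map_surjective _ _ (Submodule.mkQ_surjective _)) hq
    · rw [← hmap]
      exact LocalizedModule.map_injective _ _ hi
    · rw [← hmap]
      exact LocalizedModule.map_exact _ _ _ (exact_smul_mkQ x N)

end LocDepthGE

variable {A : Type} [CommRing A]

lemma ringKrullDim_localization_add_ringKrullDim_quotient_le (p : PrimeSpectrum A) :
    ringKrullDim (Localization.AtPrime p.1) + ringKrullDim (A ⧸ p.1) ≤ ringKrullDim A := by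
  have : Nonempty (PrimeSpectrum A) := ⟨p⟩
  have hI : (PrimeSpectrum.zeroLocus (p.1 : Set A)) = Set.Ici p := by
    ext q
    rfl
  rw [IsLocalization.AtPrime.ringKrullDim_eq_height p.1, ringKrullDim_quotient, hI,
    ← Order.coheight_eq_krullDim_Ici, PrimeSpectrum.height_eq_orderHeight, ringKrullDim,
    Order.krullDim_eq_iSup_height_add_coheight_of_nonempty, ← WithBot.coe_add]
  exact WithBot.coe_le_coe.2 (le_iSup (fun a : PrimeSpectrum A => Order.height a + Order.coheight a) p)

variable [IsLocalRing A] [IsNoetherianRing A] {d : ℕ}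

lemma DepthGE.locDepthGE (hdim : ringKrullDim A = d) {Z : Type} [AddCommGroup Z] [Module A Z]
    [Module.Finite A Z] (hZ : DepthGE A d Z) (p : PrimeSpectrum A) {t : ℕ}
    (ht : (t : WithBot ℕ∞) ≤ ringKrullDim (Localization.AtPrime p.1)) : LocDepthGE p t Z := by
  have h := (add_le_add_left ht (ringKrullDim (A ⧸ p.1))).trans
    (ringKrullDim_localization_add_ringKrullDim_quotient_le p)
  rw [hdim, ← mdim_quotient_ideal] at h
  have hpos : 0 ≤ mdim A (A ⧸ p.1) := by
    rw [mdim_quotient_ideal]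
    exact ringKrullDim_nonneg_of_nontrivial
  refine LocDepthGE.of_ext fun m hm => ModExt.subsingleton_of_mdim_lt hZ (d - t + 1) _ ?_ m ?_
  · generalize mdim A (A ⧸ p.1) = c at *
    induction c using WithBot.recBotCoe with
    | bot => simp at hpos
    | coe c =>
      induction c using ENat.recTopCoe with
      | top =>
        have := (WithBot.coe_lt_coe.2 (ENat.natCast_lt_top d)).not_ge
          ((le_add_of_nonneg_left (by positivity)).trans h)
        exact this.elim
      | coe c =>
        have h' : t + c ≤ d := by exact_mod_cast h
        have : c < d - t + 1 := by lia
        exact WithBot.coe_lt_coe.2 (Nat.cast_lt.2 this)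
  · have : t ≤ d := by
      refine Nat.cast_le (α := WithBot ℕ∞).1 (le_trans ?_ h)
      exact le_add_of_nonneg_right hpos
    lia

omit [IsLocalRing A] [IsNoetherianRing A] in
lemma serreS_iff (n : ℕ) (N : Type) [AddCommGroup N] [Module A N] :
    SerreS A n N ↔ ∀ (p : PrimeSpectrum A) (t : ℕ), t ≤ n →
      (t : WithBot ℕ∞) ≤ ringKrullDim (Localization.AtPrime p.1) → LocDepthGE p t N := by
  refine forall_congr' fun p => ⟨fun h t hn ht => ?_, fun h => ?_⟩
  · refine (natCast_le_rdepth_iff t _).1 ?_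
    exact WithBot.coe_le_coe.1 (le_trans (le_min (by exact_mod_cast hn) ht) h)
  · obtain ⟨t, ht⟩ : ∃ t : ℕ, min (n : WithBot ℕ∞) (ringKrullDim (Localization.AtPrime p.1)) = t := by
      have hpos : 0 ≤ ringKrullDim (Localization.AtPrime p.1) := ringKrullDim_nonneg_of_nontrivial
      generalize ringKrullDim (Localization.AtPrime p.1) = c at *
      induction c using WithBot.recBotCoe with
      | bot => simp at hpos
      | coe c =>
        induction c using ENat.recTopCoe with
        | top => exact ⟨n, min_eq_left (WithBot.coe_le_coe.2 le_top)⟩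
        | coe c => exact ⟨min n c, by norm_cast⟩
    rw [ht]
    refine WithBot.coe_le_coe.2 ((natCast_le_rdepth_iff t _).2 (h t ?_ ?_))
    · exact Nat.cast_le (α := WithBot ℕ∞).1 (ht ▸ min_le_left _ _)
    · exact ht ▸ min_le_right _ _

end LocalDepth

noncomputable section InjectiveDimension

open IsLocalRing

section CommRing

variable {A : Type} [CommRing A]

/-- A module of finite injective dimension on cyclic modules has finite injective dimension. -/
lemma ModExt.subsingleton_of_ideals {s : ℕ} : ∀ {W : Type} [AddCommGroup W] [Module A W],
    (∀ (I : Ideal A) (m : ℕ), s < m → Subsingleton (ModExt A m (A ⧸ I) W)) →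
    ∀ (N : Type) [AddCommGroup N] [Module A N] (m : ℕ), s < m →
      Subsingleton (ModExt A m N W) := by
  induction s with
  | zero =>
    intro W _ _ h N _ _ m hm
    have hB : Module.Baer A W := fun I f => by
      obtain ⟨e, he⟩ := ModExt.pre_surjective I.subtype_injective (LinearMap.exact_subtype_mkQ I)
        (Submodule.mkQ_surjective I) 0 (h I 1 one_pos) (ModExt.ofHom f)
      obtain ⟨g, rfl⟩ := ModExt.ofHom.surjective e
      rw [ModExt.pre_ofHom] at he
      exact ⟨g, fun x hx => LinearMap.congr_fun (ModExt.ofHom.injective he) ⟨x, hx⟩⟩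
    have := hB.injective
    have := Module.injective_object_of_injective_module A W
    obtain ⟨m, rfl⟩ := Nat.exists_eq_succ_of_ne_zero hm.ne'
    exact subsingleton_of_forall_eq 0 Abelian.Ext.eq_zero_of_injective
  | succ s ih =>
    intro W _ _ h N _ _ m hm
    obtain ⟨m, rfl⟩ := Nat.exists_eq_succ_of_ne_zero (by lia : m ≠ 0)
    let E := Injective.under (ModuleCat.of A W)
    let ι : W →ₗ[A] E := (Injective.ι (ModuleCat.of A W)).hom
    have hι : Function.Injective ι := (ModuleCat.mono_iff_injective _).1 inferInstance
    have hE (N : Type) [AddCommGroup N] [Module A N] (k : ℕ) :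
        Subsingleton (ModExt A (k + 1) N E) :=
      subsingleton_of_forall_eq 0 fun e =>
        Abelian.Ext.eq_zero_of_injective (I := E) e
    have hex := LinearMap.exact_map_mkQ_range ι
    have hs := Submodule.mkQ_surjective (LinearMap.range ι)
    have : Subsingleton (ModExt A m N (E ⧸ LinearMap.range ι)) := by
      refine ih (fun I k hk => ?_) N m (by lia)
      obtain ⟨k, rfl⟩ := Nat.exists_eq_succ_of_ne_zero (by lia : k ≠ 0)
      exact ModExt.subsingleton_post_right hι hex hs (hE _ _) (h I _ (by lia))
    exact ModExt.subsingleton_post_left hι hex hs this (hE _ _)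

lemma InjDimLE.hasFID {s : ℕ} {W : Type} [AddCommGroup W] [Module A W] (h : InjDimLE A s W) :
    HasFID A W :=
  ⟨s, fun N _ _ m hm => haveI := ModExt.subsingleton_of_ideals (fun _ m hm => h _ m hm) N m hm
    (ext1Equiv m N W).toEquiv.subsingleton⟩

end CommRing

variable {A : Type} [CommRing A] [IsLocalRing A] [IsNoetherianRing A] {d : ℕ} {ω : Type}
  [AddCommGroup ω] [Module A ω] {C : Type} [AddCommGroup C] [Module A C]

lemma IsDualizing.ext_one_dual_eq_zero (hω : IsDualizing A d ω)
    (hC : ∀ (Z : Type) [AddCommGroup Z] [Module A Z] [Module.Finite A Z], DepthGE A d Z →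
      Subsingleton (ModExt A 1 C Z)) {Z : Type} [AddCommGroup Z] [Module A Z] [Module.Finite A Z]
    (hZ : DepthGE A d Z) : Subsingleton (ModExt A 1 Z (C →ₗ[A] ω)) := by
  have := hω.finite
  obtain ⟨n, g, hg, hK⟩ := exists_syzygy hω.depth_ring Z hZ
  have hi := (LinearMap.ker g).subtype_injective
  have hex := LinearMap.exact_subtype_ker_map g
  obtain ⟨δ, hδ₁, hδ₂⟩ := ModExt.exists_pre_delta hi hex hg 0 (C →ₗ[A] ω)
  have hF : Subsingleton (ModExt A 1 (Fin n → A) (C →ₗ[A] ω)) := ModExt.subsingleton_projective 0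
  refine subsingleton_of_forall_eq 0 fun e => ?_
  obtain ⟨e', rfl⟩ := (hδ₂ e).1 (Subsingleton.elim _ _)
  obtain ⟨f, rfl⟩ := ModExt.ofHom.surjective e'
  refine (hδ₁ _).2 ?_
  obtain ⟨δ', hδ', -⟩ := ModExt.exists_post_delta (dmap_injective (Z := ω) hg) (dmap_exact hex hg)
    (dmap_surjective hi hex hg (hω.ext_eq_zero hZ one_pos)) 0 C
  have := hC _ (hω.depth_dual hZ)
  obtain ⟨h, hh⟩ := (hδ' (ModExt.ofHom f.flip)).1 (Subsingleton.elim _ _)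
  obtain ⟨h, rfl⟩ := ModExt.ofHom.surjective h
  rw [ModExt.post_ofHom] at hh
  refine ⟨ModExt.ofHom h.flip, ?_⟩
  rw [ModExt.pre_ofHom]
  congr 1
  ext x c
  exact LinearMap.congr_fun (LinearMap.congr_fun (ModExt.ofHom.injective hh) c) x

lemma IsDualizing.injDimLE_dual (hω : IsDualizing A d ω)
    (hC : ∀ (Z : Type) [AddCommGroup Z] [Module A Z] [Module.Finite A Z], DepthGE A d Z →
      Subsingleton (ModExt A 1 C Z)) : InjDimLE A d (C →ₗ[A] ω) := by
  have hd : ∀ (m : ℕ) (Z : Type) [AddCommGroup Z] [Module A Z] [Module.Finite A Z],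
      DepthGE A d Z → Subsingleton (ModExt A (m + 1) Z (C →ₗ[A] ω)) := by
    intro m
    induction m with
    | zero => exact fun Z _ _ _ hZ => hω.ext_one_dual_eq_zero hC hZ
    | succ m ih =>
      intro Z _ _ _ hZ
      obtain ⟨n, g, hg, hK⟩ := exists_syzygy hω.depth_ring Z hZ
      exact ModExt.subsingleton_pre_right (LinearMap.ker g).subtype_injective
        (LinearMap.exact_subtype_ker_map g) hg (ih _ hK) (ModExt.subsingleton_projective _)
  have key : ∀ (k : ℕ) (N : Type) [AddCommGroup N] [Module A N] [Module.Finite A N],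
      DepthGE A (d - k) N → ∀ m, k < m → Subsingleton (ModExt A m N (C →ₗ[A] ω)) := by
    intro k
    induction k with
    | zero =>
      intro N _ _ _ hN m hm
      obtain ⟨m, rfl⟩ := Nat.exists_eq_succ_of_ne_zero hm.ne'
      exact hd m N hN
    | succ k ih =>
      intro N _ _ _ hN m hm
      obtain ⟨m, rfl⟩ := Nat.exists_eq_succ_of_ne_zero (by lia : m ≠ 0)
      obtain ⟨n, g, hg⟩ := Module.Finite.exists_fin' A N
      have hi := (LinearMap.ker g).subtype_injective
      have hex := LinearMap.exact_subtype_ker_map g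
      obtain ⟨m, rfl⟩ := Nat.exists_eq_succ_of_ne_zero (by lia : m ≠ 0)
      refine ModExt.subsingleton_pre_right hi hex hg (ih _ ?_ _ (by lia))
        (ModExt.subsingleton_projective _)
      by_cases hk : k < d
      · exact (DepthGE.left hi hex hg (hω.depth_ring.pi.mono (by lia : d - (k + 1) + 1 ≤ d)) hN).mono
          (by lia)
      · intro m hm
        lia
  exact fun N _ _ _ m hm => key d N (fun k hk => by lia) m hm

end InjectiveDimension

noncomputable section Structure

open IsLocalRing

section Duals

variable {A : Type} [CommRing A] {ω : Type} [AddCommGroup ω] [Module A ω]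

lemma dmap_bijective {S C T U : Type} [AddCommGroup S] [Module A S] [AddCommGroup C] [Module A C]
    [AddCommGroup T] [Module A T] [AddCommGroup U] [Module A U] {a : S →ₗ[A] C} {u : C →ₗ[A] T}
    {c : T →ₗ[A] U} (hau : Function.Exact a u) (huc : Function.Exact u c)
    (hc : Function.Surjective c) (hS : Subsingleton (ModExt A 0 S ω))
    (hU : ∀ j ≤ 1, Subsingleton (ModExt A j U ω)) : Function.Bijective (dmap A ω u) := by
  refine ⟨(injective_iff_map_eq_zero _).2 fun ψ hψ => ?_, fun φ => ?_⟩
  · obtain ⟨χ, rfl⟩ := (dmap_exact huc hc ψ).1 hψ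
    have := ModExt.subsingleton_zero_iff.1 (hU 0 zero_le_one)
    rw [Subsingleton.elim χ 0, map_zero]
  · have hu : Function.Exact a u.rangeRestrict := fun x => by
      rw [← hau x, ← LinearMap.mem_ker, LinearMap.ker_rangeRestrict, LinearMap.mem_ker]
    have hsub : Function.Exact (LinearMap.range u).subtype c := by
      rw [LinearMap.exact_iff, Submodule.range_subtype, LinearMap.exact_iff.1 huc]
    have := ModExt.subsingleton_zero_iff.1 hS
    obtain ⟨φ', rfl⟩ := (dmap_exact (Z := ω) hu u.surjective_rangeRestrict φ).1
      (Subsingleton.elim _ _)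
    obtain ⟨ψ, rfl⟩ := dmap_surjective (LinearMap.range u).subtype_injective hsub hc
      (hU 1 le_rfl) φ'
    exact ⟨ψ, rfl⟩

variable [IsLocalRing A] [IsNoetherianRing A] {d : ℕ}

lemma codGT.ext_eq_zero {N Z : Type} [AddCommGroup N] [Module A N] [Module.Finite A N]
    [AddCommGroup Z] [Module A Z] [Module.Finite A Z] {n : ℕ} (h : codGT A d N n)
    (hZ : DepthGE A d Z) {j : ℕ} (hj : j ≤ n) : Subsingleton (ModExt A j N Z) := by
  by_cases hN : mdim A N < (0 : ℕ)
  · have := subsingleton_of_mdim_lt_zero hN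
    exact ModExt.subsingleton_left j
  obtain ⟨k, hk⟩ : ∃ k : ℕ, mdim A N = k := by
    rw [codGT] at h
    generalize mdim A N = c at *
    induction c using WithBot.recBotCoe with
    | bot => exact absurd (WithBot.bot_lt_coe _) hN
    | coe c =>
      induction c using ENat.recTopCoe with
      | top =>
        exact absurd ((WithBot.coe_lt_coe.2 (ENat.natCast_lt_top d)).le.trans
          (le_add_of_nonneg_right (by positivity))) h.not_ge
      | coe c => exact ⟨c, rfl⟩
  have h' : k + n < d := by
    rw [codGT, hk] at h
    exact_mod_cast h
  refine ModExt.subsingleton_of_mdim_lt hZ (k + 1) N ?_ j (by lia)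
  rw [hk]
  exact WithBot.coe_lt_coe.2 (Nat.cast_lt.2 (Nat.lt_succ_self k))

end Duals

variable {A : Type} [CommRing A] [IsLocalRing A] [IsNoetherianRing A] {d : ℕ} {ω : Type}
  [AddCommGroup ω] [Module A ω] {M : Type} [AddCommGroup M] [Module A M] [Module.Finite A M]
  {X : ℕ → ModuleCat.{0} A} {d0 : M →ₗ[A] ↥(X 0)} {dn : ∀ i, ↥(X i) →ₗ[A] ↥(X (i + 1))}
  {hc0 : LinearMap.range d0 ≤ LinearMap.ker (dn 0)}
  {hc : ∀ i, LinearMap.range (dn i) ≤ LinearMap.ker (dn (i + 1))}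

lemma IsDualizing.locDepthGE_dual_cokerAt (hdim : ringKrullDim A = d) (hω : IsDualizing A d ω)
    (hX : ∀ i, Module.Finite A (X i)) (hXd : ∀ i, DepthGE A d (X i))
    (hμ : ∀ i, Function.Surjective (dmap A ω (muAt A M X d0 dn hc0 hc i))) (p : PrimeSpectrum A)
    (i t : ℕ) (ht : t ≤ i + 2)
    (htp : (t : WithBot ℕ∞) ≤ ringKrullDim (Localization.AtPrime p.1)) :
    LocDepthGE p t (cokerAt A M X d0 dn i →ₗ[A] ω) := by
  have := hω.finite
  induction i generalizing t with
  | zero =>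
    obtain ⟨n, q, hq⟩ := Module.Finite.exists_fin' A M
    obtain ⟨m, a, ha⟩ := Module.Finite.exists_fin' A (LinearMap.ker q)
    have hex : Function.Exact ((LinearMap.ker q).subtype ∘ₗ a) q := by
      rw [LinearMap.exact_iff, LinearMap.range_comp, LinearMap.range_eq_top.2 ha,
        Submodule.map_top, Submodule.range_subtype]
    exact LocDepthGE.of_exact_of_le_two (dmap_injective hq) (dmap_exact hex hq) ht
      ((hω.depth_free_dual n).locDepthGE hdim p htp) ((hω.depth_free_dual m).locDepthGE hdim p htp)
  | succ i ih =>
    rcases t with _ | t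
    · exact fun m hm => by lia
    · exact LocDepthGE.left (dmap_injective (toCokerAt_surjective i))
        (dmap_exact (exact_muAt_toCokerAt i) (toCokerAt_surjective i)) (hμ i)
        ((hω.depth_dual (hXd i)).locDepthGE hdim p htp)
        (ih t (by lia) (le_trans (by exact_mod_cast t.le_succ) htp))

/-- The map `coker d^i → ker d^{i+2}` induced by `μ^{i+1}`. -/
def cokerAtToKer (hc0 : LinearMap.range d0 ≤ LinearMap.ker (dn 0))
    (hc : ∀ i, LinearMap.range (dn i) ≤ LinearMap.ker (dn (i + 1))) (i : ℕ) :
    cokerAt A M X d0 dn (i + 1) →ₗ[A] LinearMap.ker (dn (i + 1)) :=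
  (muAt A M X d0 dn hc0 hc (i + 1)).codRestrict _ fun x => by
    rw [LinearMap.mem_ker, ← muAt_comp_toCokerAt (hc0 := hc0) (hc := hc), LinearMap.comp_apply,
      (exact_muAt_toCokerAt (i + 1)).apply_apply_eq_zero, map_zero]

/-- The projection of `ker d^{i+2}` onto `ker μ^{i+2}`. -/
def kerToKerMuAt (hc0 : LinearMap.range d0 ≤ LinearMap.ker (dn 0))
    (hc : ∀ i, LinearMap.range (dn i) ≤ LinearMap.ker (dn (i + 1))) (i : ℕ) :
    LinearMap.ker (dn (i + 1)) →ₗ[A] LinearMap.ker (muAt A M X d0 dn hc0 hc (i + 2)) :=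
  (toCokerAt A M X d0 dn (i + 1)).restrict fun x hx => by
    rw [LinearMap.mem_ker, ← LinearMap.comp_apply, muAt_comp_toCokerAt]
    exact hx

omit [IsLocalRing A] [IsNoetherianRing A] [Module.Finite A M]

lemma exact_ker_muAt_cokerAtToKer (i : ℕ) :
    Function.Exact (LinearMap.ker (muAt A M X d0 dn hc0 hc (i + 1))).subtype
      (cokerAtToKer hc0 hc i) := fun x => by
  rw [← Subtype.coe_inj]
  exact LinearMap.exact_subtype_ker_map (muAt A M X d0 dn hc0 hc (i + 1)) x

lemma exact_cokerAtToKer_kerToKerMuAt (i : ℕ) :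
    Function.Exact (cokerAtToKer hc0 hc i) (kerToKerMuAt hc0 hc i) := fun x => by
  rw [← Subtype.coe_inj]
  refine (exact_muAt_toCokerAt (hc0 := hc0) (hc := hc) (i + 1) x.1).trans ⟨?_, ?_⟩
  · rintro ⟨y, hy⟩
    exact ⟨y, Subtype.ext hy⟩
  · rintro ⟨y, rfl⟩
    exact ⟨y, rfl⟩

lemma kerToKerMuAt_surjective (i : ℕ) : Function.Surjective (kerToKerMuAt hc0 hc i) := by
  rintro ⟨y, hy⟩
  obtain ⟨x, rfl⟩ := toCokerAt_surjective (i + 1) y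
  refine ⟨⟨x, ?_⟩, rfl⟩
  rw [LinearMap.mem_ker, ← muAt_comp_toCokerAt (hc0 := hc0) (hc := hc)]
  exact hy

end Structure

/-- over a Henselian CM local ring, if `0 → M → X⁰ → X¹ → ⋯` is a special proper
CM-coresolution of `M` with induced maps `μ^i : coker d^{i-1} → X^i`, then for each `i` one has
`cod (ker μ^i) > i` and there is an exact sequence `0 → S^i → coker μ^i → T^i → U^i → 0` with
`cod S^i > i+1`, `cod U^i > i+2`, `T^i` satisfying `(S_2)`, and `(T^i)†` of finite injective
dimension satisfying `(S_{i+3})`. -/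
theorem special_proper_cm_coresolution_structure (R : Type) [CommRing R] [IsNoetherianRing R]
    [HenselianLocalRing R]
    (d : ℕ) (hdim : ringKrullDim R = d) (hCM : (d : ℕ∞) ≤ rdepth R R)
    (ω : Type) [AddCommGroup ω] [Module R ω] (hω : IsCanonicalModule R d ω)
    (M : Type) [AddCommGroup M] [Module R M] [Module.Finite R M]
    (X : ℕ → ModuleCat.{0} R)
    (d0 : M →ₗ[R] ↥(X 0)) (dn : ∀ i, ↥(X i) →ₗ[R] ↥(X (i+1)))
    (hc0 : LinearMap.range d0 ≤ LinearMap.ker (dn 0))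
    (hc : ∀ i, LinearMap.range (dn i) ≤ LinearMap.ker (dn (i+1)))
    (hres : IsSpecialProperCMCoresolution R M X d0 dn hc0 hc d) :
    ∀ i : ℕ,
      codGT R d ↥(LinearMap.ker (muAt R M X d0 dn hc0 hc i)) i ∧
      ∃ (S T U : ModuleCat.{0} R)
          (a : ↥S →ₗ[R] (↥(X i) ⧸ LinearMap.range (muAt R M X d0 dn hc0 hc i)))
          (u : (↥(X i) ⧸ LinearMap.range (muAt R M X d0 dn hc0 hc i)) →ₗ[R] ↥T)
          (c : ↥T →ₗ[R] ↥U),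
        Module.Finite R ↥S ∧ Module.Finite R ↥T ∧ Module.Finite R ↥U ∧
        Function.Injective a ∧ Function.Exact a u ∧ Function.Exact u c ∧
        Function.Surjective c ∧
        codGT R d ↥S (i+1) ∧ codGT R d ↥U (i+2) ∧ SerreS R 2 ↥T ∧
        HasFID R (↥T →ₗ[R] ω) ∧ SerreS R (i+3) (↥T →ₗ[R] ω) := by
  have hωd := hω.isDualizing hdim hCM
  have := hωd.finite
  have hX i : Module.Finite R (X i) := (hres.1 i).1
  have hXd i : DepthGE R d (X i) := ((isMCM_iff d _).1 (hres.1 i)).2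
  have hμ i : Function.Surjective (dmap R ω (muAt R M X d0 dn hc0 hc i)) :=
    (hres.2 i).1.2 ω hω.1
  have hcod := hωd.codGT_ker_muAt hX hXd hμ
  have hfin := finite_cokerAt (A := R) (M := M) (d0 := d0) (dn := dn) hX
  intro i
  let e : (X i ⧸ LinearMap.range (muAt R M X d0 dn hc0 hc i)) ≃ₗ[R] cokerAt R M X d0 dn (i + 1) :=
    (exact_muAt_toCokerAt i).linearEquivOfSurjective (toCokerAt_surjective i)
  let D : (LinearMap.ker (dn (i + 1)) →ₗ[R] ω) ≃ₗ[R] (cokerAt R M X d0 dn (i + 1) →ₗ[R] ω) :=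
    .ofBijective _ (dmap_bijective (exact_ker_muAt_cokerAtToKer i)
      (exact_cokerAtToKer_kerToKerMuAt i) (kerToKerMuAt_surjective i)
      ((hcod (i + 1)).ext_eq_zero hωd.depth (by lia))
      fun j hj => (hcod (i + 2)).ext_eq_zero hωd.depth (by lia))
  have hC (Z : Type) [AddCommGroup Z] [Module R Z] [Module.Finite R Z] (hZ : DepthGE R d Z) :
      Subsingleton (ModExt R 1 (cokerAt R M X d0 dn (i + 1)) Z) :=
    haveI := (hres.2 i).2 Z ((isMCM_iff d Z).2 ⟨inferInstance, hZ⟩)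
    ((ModExt.preEquiv 1 Z e).trans (ext1Equiv 1 _ Z).symm).toEquiv.subsingleton
  have hinj : InjDimLE R d (LinearMap.ker (dn (i + 1)) →ₗ[R] ω) := fun N _ _ _ m hm =>
    haveI := hωd.injDimLE_dual hC N m hm
    (ModExt.postEquiv m N D).toEquiv.subsingleton
  refine ⟨hcod i, .of R (LinearMap.ker (muAt R M X d0 dn hc0 hc (i + 1))),
    .of R (LinearMap.ker (dn (i + 1))),
    .of R (LinearMap.ker (muAt R M X d0 dn hc0 hc (i + 2))),
    e.symm.toLinearMap ∘ₗ (LinearMap.ker (muAt R M X d0 dn hc0 hc (i + 1))).subtype,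
    cokerAtToKer hc0 hc i ∘ₗ e.toLinearMap, kerToKerMuAt hc0 hc i,
    inferInstanceAs (Module.Finite R (LinearMap.ker (muAt R M X d0 dn hc0 hc (i + 1)))),
    inferInstanceAs (Module.Finite R (LinearMap.ker (dn (i + 1)))),
    inferInstanceAs (Module.Finite R (LinearMap.ker (muAt R M X d0 dn hc0 hc (i + 2)))),
    e.symm.injective.comp (Submodule.subtype_injective _), fun x => ?_, fun x => ?_,
    kerToKerMuAt_surjective i, hcod (i + 1), hcod (i + 2), (serreS_iff 2 _).2 fun p t ht htp => ?_,
    hinj.hasFID, (serreS_iff (i + 3) _).2 fun p t ht htp => ?_⟩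
  · refine (exact_ker_muAt_cokerAtToKer i (e x)).trans ⟨?_, ?_⟩
    · rintro ⟨y, hy⟩
      exact ⟨y, e.symm_apply_eq.2 hy⟩
    · rintro ⟨y, hy⟩
      exact ⟨y, e.symm_apply_eq.1 hy⟩
  · refine (exact_cokerAtToKer_kerToKerMuAt i x).trans ⟨?_, ?_⟩
    · rintro ⟨y, rfl⟩
      exact ⟨e.symm y, congrArg (cokerAtToKer hc0 hc i) (e.apply_symm_apply y)⟩
    · rintro ⟨y, rfl⟩
      exact ⟨e y, rfl⟩
  · exact .of_exact_of_le_two (Submodule.subtype_injective _)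
      (LinearMap.exact_subtype_ker_map (dn (i + 1))) ht
      ((hXd (i + 1)).locDepthGE hdim p htp) ((hXd (i + 2)).locDepthGE hdim p htp)
  · exact (hωd.locDepthGE_dual_cokerAt hdim hX hXd hμ p (i + 1) t ht htp).of_equiv D.symm
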